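/- (i) There are no positive integers x, y, r with r > 1 satisfying x² + 1 = y^r. (ii) If x, y, r are positive integers satisfying x² + 1 = 2y^r and r > 2, then either x = y = 1 or (x, y, r) = (239, 13, 4). -/

import Mathlib

theorem GaussianInt.mul_conj (c d : ℤ) :
    (⟨c, d⟩ : GaussianInt) * ⟨c, -d⟩ = ((c ^ 2 + d ^ 2 : ℤ) : GaussianInt) := by
  ext
  · rw [Zsqrtd.re_intCast]; simp; ring
  · rw [Zsqrtd.im_intCast]; simp; ring

/-- A Gaussian integer coprime to its conjugate whose norm is an `r`-th power is an `r`-th power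
up to a unit. -/
theorem GaussianInt.exists_associated_pow {c d y : ℤ} {r : ℕ}
    (hcop : IsCoprime (⟨c, d⟩ : GaussianInt) ⟨c, -d⟩) (h : c ^ 2 + d ^ 2 = y ^ r) :
    ∃ z : GaussianInt, Associated (z ^ r) ⟨c, d⟩ := by
  refine exists_associated_pow_of_mul_eq_pow' hcop (c := (y : GaussianInt)) ?_
  rw [← Int.cast_pow, ← h, GaussianInt.mul_conj]

/-- A primitive Gaussian integer of odd norm is coprime to its conjugate. -/
theorem GaussianInt.isCoprime_conj {c d : ℤ} (hodd : Odd (c ^ 2 + d ^ 2))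
    (h : ∃ u v : ℤ, u * c + v * d = 1) :
    IsCoprime (⟨c, d⟩ : GaussianInt) ⟨c, -d⟩ := by
  obtain ⟨u, v, huv⟩ := h
  obtain ⟨k, hk⟩ := hodd
  have h2 : (⟨u, -v⟩ : GaussianInt) * ⟨c, d⟩ + ⟨u, v⟩ * ⟨c, -d⟩ = 2 := by
    ext <;> simp <;> linarith
  have hN : (⟨c, d⟩ : GaussianInt) * ⟨c, -d⟩ = 1 + (k : GaussianInt) * 2 := by
    ext <;> simp <;> linarith
  refine ⟨⟨c, -d⟩ - (k : GaussianInt) * ⟨u, -v⟩, -(k : GaussianInt) * ⟨u, v⟩, ?_⟩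
  linear_combination hN - (k : GaussianInt) * h2

theorem GaussianInt.isUnit_cases {u : GaussianInt} (hu : IsUnit u) :
    u = 1 ∨ u = -1 ∨ u = ⟨0, 1⟩ ∨ u = ⟨0, -1⟩ := by
  obtain ⟨v, rfl⟩ := hu
  have h := (Zsqrtd.norm_eq_one_iff' (by norm_num) (v : GaussianInt)).2 v.isUnit
  generalize (v : GaussianInt) = w at h
  obtain ⟨a, b⟩ := w
  simp only [Zsqrtd.norm_def] at h
  have h1 : a * a + b * b = 1 := by linarith
  have ha : a ≤ 1 := by nlinarith
  have ha' : -1 ≤ a := by nlinarith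
  have hb : b ≤ 1 := by nlinarith
  have hb' : -1 ≤ b := by nlinarith
  simp only [Zsqrtd.ext_iff]
  interval_cases a <;> interval_cases b <;> simp_all

/-- For odd `r` every unit of `ℤ[i]` is an `r`-th power. -/
theorem GaussianInt.exists_pow_eq_of_isUnit {u : GaussianInt} (hu : IsUnit u) {r : ℕ}
    (hr : Odd r) : ∃ v : GaussianInt, v ^ r = u := by
  obtain ⟨v, rfl⟩ := hu
  have h4 : ((v : GaussianInt)) ^ 4 = 1 := by
    rcases GaussianInt.isUnit_cases v.isUnit with h | h | h | h <;> rw [h] <;> decide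
  obtain ⟨k, rfl⟩ := hr
  refine ⟨v ^ (2 * k + 1), ?_⟩
  rw [← pow_mul, show (2 * k + 1) * (2 * k + 1) = 4 * (k * k + k) + 1 by ring, pow_succ, pow_mul,
    h4, one_pow, one_mul]

theorem two_pow_dvd_choose_mul {r k N : ℕ} {b : ℤ} (hb : Even b) (hk : 3 ≤ k)
    (hN : (2 : ℤ) ^ N ∣ r * (r - 1) * b ^ 2) : (2 : ℤ) ^ N ∣ r.choose k * b ^ k := by
  obtain ⟨j, rfl⟩ : ∃ j, k = j + 2 := ⟨k - 2, by omega⟩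
  obtain ⟨e, o, ho, hkk⟩ := Nat.exists_eq_two_pow_mul_odd
    (show (j + 1) * (j + 2) ≠ 0 by positivity)
  have he : e ≤ j := by
    have h2 : 2 ^ e ∣ j + 1 ∨ 2 ^ e ∣ j + 2 := by
      have hd : 2 ^ e ∣ (j + 1) * (j + 2) := ⟨o, hkk⟩
      rcases Nat.even_or_odd j with hj | hj
      · right
        refine Nat.Coprime.dvd_of_dvd_mul_left ?_ hd
        exact Nat.Coprime.pow_left _ (Nat.coprime_two_left.2 hj.add_one)
      · left
        refine Nat.Coprime.dvd_of_dvd_mul_right ?_ hd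
        exact Nat.Coprime.pow_left _ (Nat.coprime_two_left.2 (by
          rw [Nat.odd_add]; simpa using hj))
    have hle : 2 ^ e ≤ j + 2 := by
      rcases h2 with h | h
      · exact (Nat.le_of_dvd (by omega) h).trans (by omega)
      · exact Nat.le_of_dvd (by omega) h
    by_contra! hlt
    have h3 : 2 ^ (j + 1) ≤ 2 ^ e := Nat.pow_le_pow_right (by norm_num) hlt
    have h4 : ∀ i : ℕ, 1 ≤ i → i + 2 < 2 ^ (i + 1) := by
      intro i hi
      induction i, hi using Nat.le_induction with
      | base => norm_num
      | succ i hi ih => rw [pow_succ]; omega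
    have := h4 j (by omega)
    omega
  have hch : ((j + 1 : ℤ) * (j + 2)) * r.choose (j + 2) = r * (r - 1) * ((r - 2).choose j : ℕ) := by
    rcases r with _ | _ | r
    · simp
    · simp [Nat.choose_eq_zero_of_lt]
    · have h1 := Nat.add_one_mul_choose_eq (r + 1) (j + 1)
      have h2 := Nat.add_one_mul_choose_eq r j
      have h1' : ((r : ℤ) + 1 + 1) * (r + 1).choose (j + 1) =
          (r + 2).choose (j + 2) * (j + 1 + 1) := by
        exact_mod_cast h1
      have h2' : ((r : ℤ) + 1) * r.choose j = (r + 1).choose (j + 1) * (j + 1) := by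
        exact_mod_cast h2
      push_cast
      linear_combination (-(j + 1 : ℤ)) * h1' - ((r : ℤ) + 2) * h2'
  obtain ⟨b', rfl⟩ := hb.two_dvd
  obtain ⟨t, ht⟩ := hN
  have hkk' : ((j + 1 : ℤ) * (j + 2)) = 2 ^ e * o := by exact_mod_cast hkk
  have hcop : IsCoprime ((2 : ℤ) ^ N) (o : ℤ) := by
    apply IsCoprime.pow_left
    exact_mod_cast Nat.isCoprime_iff_coprime.2 (Nat.coprime_two_left.2 ho)
  refine hcop.dvd_of_dvd_mul_left ?_
  obtain ⟨i, rfl⟩ := Nat.exists_eq_add_of_le he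
  refine ⟨t * ((r - 2).choose (e + i) : ℕ) * 2 ^ i * b' ^ (e + i), ?_⟩
  have h2e : (2 : ℤ) ^ e ≠ 0 := by positivity
  apply mul_left_cancel₀ h2e
  have e1 : (2 * b') ^ (e + i + 2) = (2 * b') ^ 2 * (2 ^ e * 2 ^ i * b' ^ (e + i)) := by ring
  rw [e1]
  rw [hkk'] at hch
  linear_combination ((2 * b') ^ 2 * (2 ^ e * 2 ^ i * b' ^ (e + i))) * hch +
    ((r - 2).choose (e + i) : ℕ) * (2 ^ e * 2 ^ i * b' ^ (e + i)) * ht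

/-- Second-order binomial expansion of `(1 + b η) ^ r`, `b` even, 2-adically. -/
theorem one_add_mul_pow_expansion {R : Type*} [CommRing R] {r N : ℕ} {b : ℤ} (hb : Even b)
    (hN : (2 : ℤ) ^ N ∣ r * (r - 1) * b ^ 2) (η : R) :
    ∃ κ : R, (1 + b * η) ^ r = 1 + r * (b * η) + r.choose 2 * (b * η) ^ 2
      + 2 ^ N * (η ^ 3 * κ) := by
  have hk : ∀ k, ∃ κ : R, (b * η) ^ (k + 3) * r.choose (k + 3) = 2 ^ N * (η ^ 3 * κ) := by
    intro k
    obtain ⟨t, ht⟩ := two_pow_dvd_choose_mul (k := k + 3) hb (by omega) hN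
    refine ⟨t * η ^ k, ?_⟩
    have ht' := congrArg (Int.cast : ℤ → R) ht
    push_cast at ht'
    rw [mul_pow]
    linear_combination η ^ (k + 3) * ht'
  choose κ hκ using hk
  have hsum : (1 + b * η) ^ r = ∑ k ∈ Finset.range (r + 3), (b * η) ^ k * r.choose k := by
    rw [add_comm, add_pow]
    simp only [one_pow, mul_one]
    refine Finset.sum_subset (by simp) fun k _ hk => ?_
    rw [Nat.choose_eq_zero_of_lt (by simpa using hk)]
    simp
  refine ⟨∑ k ∈ Finset.range r, κ k, ?_⟩
  rw [hsum, Finset.sum_range_succ', Finset.sum_range_succ', Finset.sum_range_succ',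
    Finset.sum_congr rfl fun k _ => hκ k, Finset.mul_sum, Finset.mul_sum]
  simp
  ring

theorem exists_two_pow_mul_odd {A : ℤ} (hA : A ≠ 0) :
    ∃ (N : ℕ) (o : ℤ), Odd o ∧ A = 2 ^ N * o := by
  have hfin : FiniteMultiplicity (2 : ℤ) A := Int.finiteMultiplicity_iff.2 ⟨by norm_num, hA⟩
  obtain ⟨o, h, ho⟩ := hfin.exists_eq_pow_mul_and_not_dvd
  exact ⟨_, o, by simpa [← even_iff_two_dvd] using ho, h⟩

theorem two_mul_choose_two (r : ℕ) : 2 * (r.choose 2 : ℤ) = r * (r - 1) := by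
  rcases r with _ | r
  · simp
  · have := Nat.add_one_mul_choose_eq r 1
    simp only [Nat.choose_one_right] at this
    have h : ((r : ℤ) + 1) * r = (r + 1).choose 2 * (1 + 1) := by exact_mod_cast this
    push_cast
    linarith

/-- The expansion of `(1 + B η) ^ r` modulo `η ^ 3 P`, where `P` is the exact power of `2` dividing
`r (r - 1) B ^ 2`. -/
theorem exists_one_add_mul_pow_eq {r : ℕ} (hr : 2 ≤ r) {B : ℤ} (hB : Even B) (hB0 : B ≠ 0)
    (η : GaussianInt) : ∃ (P o : ℤ) (κ : GaussianInt), P ≠ 0 ∧ 8 ∣ P ∧ Odd o ∧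
      (r : ℤ) * (r - 1) * B ^ 2 = P * o ∧
      (1 + B * η) ^ r = 1 + r * (B * η) + r.choose 2 * (B * η) ^ 2 + P * (η ^ 3 * κ) := by
  have hr' : (2 : ℤ) ≤ r := by exact_mod_cast hr
  obtain ⟨N, o, ho, h⟩ := exists_two_pow_mul_odd (A := (r : ℤ) * (r - 1) * B ^ 2) (by
    have : (r : ℤ) - 1 ≠ 0 := by omega
    positivity)
  obtain ⟨κ, hκ⟩ := one_add_mul_pow_expansion hB ⟨o, h⟩ η
  refine ⟨2 ^ N, o, κ, by positivity, ?_, ho, h, by rw [hκ]; push_cast; rfl⟩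
  have hcop : IsCoprime (8 : ℤ) o := by
    rw [show (8 : ℤ) = 2 ^ 3 by norm_num]
    exact IsCoprime.pow_left (Int.isCoprime_two_left.2 ho)
  refine hcop.dvd_of_dvd_mul_right ?_
  rw [← h, ← two_mul_choose_two]
  obtain ⟨b, rfl⟩ := hB.two_dvd
  exact ⟨r.choose 2 * b ^ 2, by ring⟩

theorem eq_zero_of_re_one_add_mul_I_pow {r : ℕ} (hr : 2 ≤ r) {B : ℤ} (hB : Even B)
    (h : ((1 + B * (⟨0, 1⟩ : GaussianInt)) ^ r).re = 1 ∨
      ((1 + B * (⟨0, 1⟩ : GaussianInt)) ^ r).re = -1) : B = 0 := by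
  by_contra hB0
  obtain ⟨P, o, ⟨κ₁, κ₂⟩, hP, ⟨q, rfl⟩, ⟨m, rfl⟩, hA, hκ⟩ :=
    exists_one_add_mul_pow_eq hr hB hB0 ⟨0, 1⟩
  have hre := congrArg Zsqrtd.re hκ
  have key : ((1 + B * (⟨0, 1⟩ : GaussianInt)) ^ r).re
      = 1 - r.choose 2 * B ^ 2 + 8 * q * κ₂ := by
    rw [hre]
    simp only [pow_succ, pow_zero, one_mul, Zsqrtd.re_add, Zsqrtd.re_mul, Zsqrtd.im_mul,
      Zsqrtd.re_intCast, Zsqrtd.im_intCast, Zsqrtd.re_natCast, Zsqrtd.im_natCast,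
      Zsqrtd.re_one]
    ring
  rw [key] at h
  have h3 : 2 * ((r.choose 2 : ℤ) * B ^ 2) = 8 * q * (2 * m + 1) := by
    rw [← hA, ← two_mul_choose_two r]; ring
  rcases h with h | h
  · have : 8 * q * (2 * (κ₂ - m) - 1) = 0 := by linarith
    rcases mul_eq_zero.1 this with h | h
    · exact hP h
    · omega
  · have : 2 * (1 - 4 * (q * (2 * m + 1)) + 8 * (q * κ₂)) = -2 + 0 * B := by
      have := h3
      ring_nf at *
      linarith
    omega

theorem eq_zero_of_re_add_im_pow {r : ℕ} (hr : 2 ≤ r) {B : ℤ} (hB : Even B)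
    (h : ((1 + B * (⟨-1, 1⟩ : GaussianInt)) ^ r).re +
        ((1 + B * (⟨-1, 1⟩ : GaussianInt)) ^ r).im = 1 ∨
      ((1 + B * (⟨-1, 1⟩ : GaussianInt)) ^ r).re +
        ((1 + B * (⟨-1, 1⟩ : GaussianInt)) ^ r).im = -1) : B = 0 := by
  by_contra hB0
  obtain ⟨P, o, ⟨κ₁, κ₂⟩, hP, ⟨q, rfl⟩, ⟨m, rfl⟩, hA, hκ⟩ :=
    exists_one_add_mul_pow_eq hr hB hB0 ⟨-1, 1⟩
  have key : ((1 + B * (⟨-1, 1⟩ : GaussianInt)) ^ r).re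
      + ((1 + B * (⟨-1, 1⟩ : GaussianInt)) ^ r).im
      = 1 - 2 * r.choose 2 * B ^ 2 + 32 * (q * κ₁) := by
    rw [hκ]
    simp only [pow_succ, pow_zero, one_mul, Zsqrtd.re_add, Zsqrtd.re_mul, Zsqrtd.im_mul,
      Zsqrtd.im_add, Zsqrtd.im_one,
      Zsqrtd.re_intCast, Zsqrtd.im_intCast, Zsqrtd.re_natCast, Zsqrtd.im_natCast,
      Zsqrtd.re_one]
    ring
  rw [key, two_mul_choose_two, hA] at h
  rcases h with h | h
  · have : 8 * q * (2 * (2 * κ₁ - m) - 1) = 0 := by linarith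
    rcases mul_eq_zero.1 this with h | h
    · exact hP h
    · omega
  · have : 1 - 8 * (q * (2 * m + 1)) + 32 * (q * κ₁) = -1 := by linarith
    omega

theorem eq_zero_of_re_sub_im_pow {r : ℕ} (hr : 2 ≤ r) (hodd : Odd r) {B : ℤ} (hB : Even B)
    (h : ((1 + B * (⟨-1, 1⟩ : GaussianInt)) ^ r).re -
        ((1 + B * (⟨-1, 1⟩ : GaussianInt)) ^ r).im = 1 ∨
      ((1 + B * (⟨-1, 1⟩ : GaussianInt)) ^ r).re -
        ((1 + B * (⟨-1, 1⟩ : GaussianInt)) ^ r).im = -1) : B = 0 := by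
  by_contra hB0
  obtain ⟨P, o, ⟨κ₁, κ₂⟩, hP, ⟨q, rfl⟩, ⟨m, rfl⟩, hA, hκ⟩ :=
    exists_one_add_mul_pow_eq hr hB hB0 ⟨-1, 1⟩
  have key : ((1 + B * (⟨-1, 1⟩ : GaussianInt)) ^ r).re
      - ((1 + B * (⟨-1, 1⟩ : GaussianInt)) ^ r).im
      = 1 - 2 * (r * B) + 2 * r.choose 2 * B ^ 2 - 32 * (q * κ₂) := by
    rw [hκ]
    simp only [pow_succ, pow_zero, one_mul, Zsqrtd.re_add, Zsqrtd.re_mul, Zsqrtd.im_mul,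
      Zsqrtd.im_add, Zsqrtd.im_one,
      Zsqrtd.re_intCast, Zsqrtd.im_intCast, Zsqrtd.re_natCast, Zsqrtd.im_natCast,
      Zsqrtd.re_one]
    ring
  rw [key, two_mul_choose_two, hA] at h
  obtain ⟨s, rfl⟩ := hodd
  obtain ⟨b, rfl⟩ := hB.two_dvd
  push_cast at h hA
  rcases h with h | h
  · have h1 : 4 * ((2 * s + 1) * b) = 8 * q * (2 * m + 1 - 4 * κ₂) := by linarith
    have h2 : 4 * ((2 * s + 1 : ℤ) * b) * ((2 * m + 1) - 2 * s * b * (2 * m + 1 - 4 * κ₂)) = 0 := by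
      linear_combination (2 * m + 1) * h1 - (2 * m + 1 - 4 * κ₂) * hA
    rcases mul_eq_zero.1 h2 with h | h
    · have : (2 * s + 1 : ℤ) ≠ 0 := by omega
      simp_all
    · have : 2 * (m - s * b * (2 * m + 1 - 4 * κ₂)) + 1 = 0 := by linarith
      omega
  · have : 1 - 4 * ((2 * s + 1) * b) + 8 * (q * (2 * m + 1)) - 32 * (q * κ₂) = -1 := by linarith
    omega

theorem dvd_im_pow (a b : ℤ) (r : ℕ) : b ∣ ((⟨a, b⟩ : GaussianInt) ^ r).im := by
  induction r with
  | zero => simp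
  | succ r ih =>
    rw [pow_succ, Zsqrtd.im_mul]
    exact dvd_add (dvd_mul_left _ _) (ih.mul_right _)

theorem GaussianInt.norm_pow (z : GaussianInt) (r : ℕ) : (z ^ r).norm = z.norm ^ r :=
  map_pow Zsqrtd.normMonoidHom z r

theorem I_pow_of_mod_four_one {r : ℕ} (hr : r % 4 = 1) : (⟨0, 1⟩ : GaussianInt) ^ r = ⟨0, 1⟩ := by
  rw [← Nat.div_add_mod r 4, hr, pow_succ, pow_mul,
    show (⟨0, 1⟩ : GaussianInt) ^ 4 = 1 by decide, one_pow, one_mul]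

theorem I_pow_of_mod_four_three {r : ℕ} (hr : r % 4 = 3) :
    (⟨0, 1⟩ : GaussianInt) ^ r = ⟨0, -1⟩ := by
  rw [← Nat.div_add_mod r 4, hr, pow_add, pow_mul,
    show (⟨0, 1⟩ : GaussianInt) ^ 4 = 1 by decide, one_pow, one_mul]
  decide

theorem GaussianInt.conj_pow (a b : ℤ) (r : ℕ) : (⟨a, -b⟩ : GaussianInt) ^ r =
    ⟨((⟨a, b⟩ : GaussianInt) ^ r).re, -((⟨a, b⟩ : GaussianInt) ^ r).im⟩ := by
  have h := star_pow (⟨a, b⟩ : GaussianInt) r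
  rw [show star (⟨a, b⟩ : GaussianInt) = ⟨a, -b⟩ from rfl] at h
  rw [← h]
  rfl

theorem swap_pow_of_mod_four_one {r : ℕ} (hr : r % 4 = 1) (a b : ℤ) :
    (⟨b, a⟩ : GaussianInt) ^ r =
      ⟨((⟨a, b⟩ : GaussianInt) ^ r).im, ((⟨a, b⟩ : GaussianInt) ^ r).re⟩ := by
  rw [show (⟨b, a⟩ : GaussianInt) = ⟨0, 1⟩ * ⟨a, -b⟩ by ext <;> simp, mul_pow, GaussianInt.conj_pow,
    I_pow_of_mod_four_one hr]
  ext <;> simp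

theorem swap_pow_of_mod_four_three {r : ℕ} (hr : r % 4 = 3) (a b : ℤ) :
    (⟨b, a⟩ : GaussianInt) ^ r =
      ⟨-((⟨a, b⟩ : GaussianInt) ^ r).im, -((⟨a, b⟩ : GaussianInt) ^ r).re⟩ := by
  rw [show (⟨b, a⟩ : GaussianInt) = ⟨0, 1⟩ * ⟨a, -b⟩ by ext <;> simp, mul_pow, GaussianInt.conj_pow,
    I_pow_of_mod_four_three hr]
  ext <;> simp

/-- Lebesgue's theorem for odd exponents. -/
theorem lebesgue_odd {x y : ℤ} {r : ℕ} (hr : 2 ≤ r) (hodd : Odd r) (h : x ^ 2 + 1 = y ^ r) :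
    x = 0 := by
  have hx : Even x := by
    by_contra hx
    rw [Int.not_even_iff_odd] at hx
    obtain ⟨k, rfl⟩ := hx
    rcases Int.even_or_odd y with hy | hy
    · have : (2 : ℤ) ^ 2 ∣ y ^ r := (pow_dvd_pow_of_dvd hy.two_dvd 2).trans (pow_dvd_pow y hr)
      obtain ⟨q, hq⟩ := this
      have : 2 * (2 * (k ^ 2 + k)) + 2 = 4 * q := by linarith
      omega
    · obtain ⟨q, hq⟩ := hy.pow (n := r)
      have : 2 * (2 * (k ^ 2 + k)) + 2 = 2 * q + 1 := by linarith
      omega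
  have hodd2 : Odd (x ^ 2 + 1 ^ 2) := by
    rw [one_pow]; exact (hx.pow_of_ne_zero two_ne_zero).add_one
  obtain ⟨z, u, hu⟩ := GaussianInt.exists_associated_pow
    (GaussianInt.isCoprime_conj hodd2 ⟨0, 1, by ring⟩) (by rw [← h]; ring)
  obtain ⟨v, hv⟩ := GaussianInt.exists_pow_eq_of_isUnit u.isUnit hodd
  rw [← hv, ← mul_pow] at hu
  generalize z * v = w at hu
  obtain ⟨a, b⟩ := w
  have hb : b * b = 1 := by
    have := dvd_im_pow a b r
    rw [hu] at this
    rcases Int.isUnit_iff.1 (isUnit_of_dvd_one this) with h | h <;> rw [h] <;> rfl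
  have hnorm : (a * a + b * b) ^ r = x ^ 2 + 1 := by
    have := GaussianInt.norm_pow (⟨a, b⟩ : GaussianInt) r
    rw [hu] at this
    simp only [Zsqrtd.norm_def] at this
    linear_combination -this
  have ha : Even a := by
    by_contra ha
    rw [Int.not_even_iff_odd] at ha
    have h1 : Even ((a * a + b * b) ^ r) := by
      refine Even.pow_of_ne_zero ?_ (by omega)
      rw [hb]
      exact (ha.mul ha).add_one
    rw [hnorm] at h1
    exact (Int.not_even_iff_odd.2 (by simpa using hodd2)) h1
  have hfac : (⟨a, b⟩ : GaussianInt) =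
      (b : GaussianInt) * (⟨0, 1⟩ * (1 + ((-(a * b) : ℤ) : GaussianInt) * ⟨0, 1⟩)) := by
    ext
    · simp; linear_combination (-a) * hb
    · simp
  have hbr : b ^ r = 1 ∨ b ^ r = -1 := by
    rcases Int.isUnit_iff.1 (IsUnit.of_mul_eq_one b hb) with h | h <;> rw [h]
    · simp
    · exact neg_one_pow_eq_or ℤ r
  have hB : -(a * b) = 0 := by
    refine eq_zero_of_re_one_add_mul_I_pow hr (ha.mul_right b).neg ?_
    rw [hfac, mul_pow, mul_pow] at hu
    have him := congrArg Zsqrtd.im hu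
    have h4 : r % 4 = 1 ∨ r % 4 = 3 := by
      obtain ⟨s, rfl⟩ := hodd; omega
    rw [← Int.cast_pow] at him
    rcases h4 with h4 | h4
    · rw [I_pow_of_mod_four_one h4] at him
      rcases hbr with h | h <;> rw [h] at him <;> simp at him ⊢ <;> omega
    · rw [I_pow_of_mod_four_three h4] at him
      rcases hbr with h | h <;> rw [h] at him <;> simp at him ⊢ <;> omega
  have ha0 : a = 0 := by
    have : a * (b * b) = 0 := by linear_combination (-b) * hB
    rw [hb] at this; simpa using this
  rw [ha0, hb] at hnorm
  simp at hnorm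
  exact hnorm

theorem add_dvd_re_add_im_pow {r : ℕ} (hr : r % 4 = 1) (a b : ℤ) :
    a + b ∣ ((⟨a, b⟩ : GaussianInt) ^ r).re + ((⟨a, b⟩ : GaussianInt) ^ r).im := by
  obtain ⟨w, hw⟩ := sub_dvd_pow_sub_pow (⟨a, b⟩ : GaussianInt) ((a : GaussianInt) * ⟨1, -1⟩) r
  have h1 : (⟨1, -1⟩ : GaussianInt) ^ r = (((-4) ^ (r / 4) : ℤ) : GaussianInt) * ⟨1, -1⟩ := by
    conv_lhs => rw [← Nat.div_add_mod r 4, hr, pow_succ, pow_mul]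
    rw [show (⟨1, -1⟩ : GaussianInt) ^ 4 = ((-4 : ℤ) : GaussianInt) by decide]
    simp
  rw [mul_pow, h1, ← Int.cast_pow,
    show (⟨a, b⟩ : GaussianInt) - (a : GaussianInt) * ⟨1, -1⟩ = ((a + b : ℤ) : GaussianInt) * ⟨0, 1⟩
      by ext <;> simp [add_comm]] at hw
  have hre := congrArg Zsqrtd.re hw
  have him := congrArg Zsqrtd.im hw
  simp only [Zsqrtd.re_sub, Zsqrtd.im_sub, Zsqrtd.re_mul, Zsqrtd.im_mul, Zsqrtd.re_intCast,
    Zsqrtd.im_intCast] at hre him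
  refine ⟨w.re - w.im, ?_⟩
  linear_combination hre + him

theorem add_dvd_re_sub_im_pow {r : ℕ} (hr : r % 4 = 3) (a b : ℤ) :
    a + b ∣ ((⟨a, b⟩ : GaussianInt) ^ r).re - ((⟨a, b⟩ : GaussianInt) ^ r).im := by
  obtain ⟨w, hw⟩ := sub_dvd_pow_sub_pow (⟨a, b⟩ : GaussianInt) ((a : GaussianInt) * ⟨1, -1⟩) r
  have h1 : (⟨1, -1⟩ : GaussianInt) ^ r = (((-4) ^ (r / 4) : ℤ) : GaussianInt) * ⟨-2, -2⟩ := by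
    conv_lhs => rw [← Nat.div_add_mod r 4, hr, pow_add, pow_mul]
    rw [show (⟨1, -1⟩ : GaussianInt) ^ 4 = ((-4 : ℤ) : GaussianInt) by decide,
      show (⟨1, -1⟩ : GaussianInt) ^ 3 = ⟨-2, -2⟩ by decide]
    simp
  rw [mul_pow, h1, ← Int.cast_pow,
    show (⟨a, b⟩ : GaussianInt) - (a : GaussianInt) * ⟨1, -1⟩ = ((a + b : ℤ) : GaussianInt) * ⟨0, 1⟩
      by ext <;> simp [add_comm]] at hw
  have hre := congrArg Zsqrtd.re hw
  have him := congrArg Zsqrtd.im hw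
  simp only [Zsqrtd.re_sub, Zsqrtd.im_sub, Zsqrtd.re_mul, Zsqrtd.im_mul, Zsqrtd.re_intCast,
    Zsqrtd.im_intCast] at hre him
  refine ⟨-w.re - w.im, ?_⟩
  linear_combination hre - him

theorem pow_eq_of_add_eq {a b s : ℤ} (hs : a + b = s) (hs2 : s * s = 1) (r : ℕ) :
    (⟨a, b⟩ : GaussianInt) ^ r =
      ((s ^ r : ℤ) : GaussianInt) * (1 + ((s * b : ℤ) : GaussianInt) * ⟨-1, 1⟩) ^ r := by
  rw [Int.cast_pow, ← mul_pow]
  congr 1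
  ext
  · simp; linear_combination hs + b * hs2
  · simp; linear_combination (-b) * hs2

theorem eq_zero_of_mod_four_one {r : ℕ} (hr : 2 ≤ r) (h4 : r % 4 = 1) {a b : ℤ} (hb : Even b)
    (h : ((⟨a, b⟩ : GaussianInt) ^ r).re + ((⟨a, b⟩ : GaussianInt) ^ r).im = 1) : b = 0 := by
  have hd := add_dvd_re_add_im_pow h4 a b
  rw [h] at hd
  have hs : (a + b) * (a + b) = 1 := by
    rcases Int.isUnit_iff.1 (isUnit_of_dvd_one hd) with h | h <;> rw [h] <;> rfl
  have hsr : (a + b) ^ r = 1 ∨ (a + b) ^ r = -1 := by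
    rcases Int.isUnit_iff.1 (isUnit_of_dvd_one hd) with h | h <;> rw [h]
    · simp
    · exact neg_one_pow_eq_or ℤ r
  have hB := eq_zero_of_re_add_im_pow hr (B := (a + b) * b) (hb.mul_left _) (by
    rw [pow_eq_of_add_eq rfl hs] at h
    simp only [Zsqrtd.re_mul, Zsqrtd.im_mul, Zsqrtd.re_intCast, Zsqrtd.im_intCast] at h
    rcases hsr with h' | h' <;> rw [h'] at h
    · left; linarith
    · right; linarith)
  have : (a + b) * (a + b) * b = 0 := by linear_combination (a + b) * hB
  rwa [hs, one_mul] at this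

theorem eq_zero_of_mod_four_three {r : ℕ} (hr : 2 ≤ r) (h4 : r % 4 = 3) {a b : ℤ} (hb : Even b)
    (h : ((⟨a, b⟩ : GaussianInt) ^ r).re - ((⟨a, b⟩ : GaussianInt) ^ r).im = 1) : b = 0 := by
  have hd := add_dvd_re_sub_im_pow h4 a b
  rw [h] at hd
  have hs : (a + b) * (a + b) = 1 := by
    rcases Int.isUnit_iff.1 (isUnit_of_dvd_one hd) with h | h <;> rw [h] <;> rfl
  have hsr : (a + b) ^ r = 1 ∨ (a + b) ^ r = -1 := by
    rcases Int.isUnit_iff.1 (isUnit_of_dvd_one hd) with h | h <;> rw [h]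
    · simp
    · exact neg_one_pow_eq_or ℤ r
  have hodd : Odd r := Nat.odd_iff.2 (by omega)
  have hB := eq_zero_of_re_sub_im_pow hr hodd (B := (a + b) * b) (hb.mul_left _) (by
    rw [pow_eq_of_add_eq rfl hs] at h
    simp only [Zsqrtd.re_mul, Zsqrtd.im_mul, Zsqrtd.re_intCast, Zsqrtd.im_intCast] at h
    rcases hsr with h' | h' <;> rw [h'] at h
    · left; linarith
    · right; linarith)
  have : (a + b) * (a + b) * b = 0 := by linear_combination (a + b) * hB
  rwa [hs, one_mul] at this

/-- If `x ^ 2 + 1 = 2 Y`, then `x + i = (1 + i) (c + d i)` where `c + d i` is coprime to its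
conjugate. -/
theorem exists_isCoprime_conj {x Y : ℤ} (h : x ^ 2 + 1 = 2 * Y) :
    ∃ c d : ℤ, c + d = 1 ∧ c - d = x ∧ c ^ 2 + d ^ 2 = Y ∧ Odd Y ∧
      IsCoprime (⟨c, d⟩ : GaussianInt) ⟨c, -d⟩ := by
  have hx : Odd x := by
    by_contra hx
    rw [Int.not_odd_iff_even] at hx
    obtain ⟨k, rfl⟩ := hx
    have : 2 * (2 * k ^ 2 ) + 1 = Y * 2 := by linarith
    omega
  obtain ⟨k, rfl⟩ := hx
  have hY : (k + 1) ^ 2 + (-k) ^ 2 = Y := by linarith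
  have hodd : Odd ((k + 1) ^ 2 + (-k) ^ 2) := ⟨k ^ 2 + k, by ring⟩
  exact ⟨k + 1, -k, by ring, by ring, hY, hY ▸ hodd,
    GaussianInt.isCoprime_conj hodd ⟨1, 1, by ring⟩⟩

/-- Størmer's theorem for odd exponents. -/
theorem stormer_odd {x y : ℤ} {r : ℕ} (hr : 2 ≤ r) (hodd : Odd r) (h : x ^ 2 + 1 = 2 * y ^ r) :
    x ^ 2 = 1 := by
  obtain ⟨c, d, hcd, rfl, hn, hY, hcop⟩ := exists_isCoprime_conj h
  obtain ⟨z, u, hu⟩ := GaussianInt.exists_associated_pow hcop hn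
  obtain ⟨v, hv⟩ := GaussianInt.exists_pow_eq_of_isUnit u.isUnit hodd
  rw [← hv, ← mul_pow] at hu
  generalize z * v = w at hu
  obtain ⟨a, b⟩ := w
  have hnorm : (a * a + b * b) ^ r = c ^ 2 + d ^ 2 := by
    have := GaussianInt.norm_pow (⟨a, b⟩ : GaussianInt) r
    rw [hu] at this
    simp only [Zsqrtd.norm_def] at this
    linear_combination -this
  have hodd2 : Odd (a * a + b * b) := by
    rw [← hn, ← hnorm] at hY
    exact (Int.odd_pow.1 hY).resolve_right (by omega)
  have hab : Even a ∨ Even b := by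
    by_contra! hne
    rw [Int.not_even_iff_odd, Int.not_even_iff_odd] at hne
    exact (Int.not_even_iff_odd.2 hodd2) ((hne.1.mul hne.1).add_odd (hne.2.mul hne.2))
  have h4 : r % 4 = 1 ∨ r % 4 = 3 := by
    obtain ⟨s, rfl⟩ := hodd; omega
  have hac : a ∣ c := by
    have hd := dvd_im_pow b a r
    rcases h4 with h4 | h4
    · rw [swap_pow_of_mod_four_one h4, hu] at hd
      exact hd
    · rw [swap_pow_of_mod_four_three h4, hu] at hd
      exact (dvd_neg.1 hd)
  have key : a * b = 0 := by
    rcases h4 with h4 | h4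
    · rcases hab with ha | hb
      · rw [eq_zero_of_mod_four_one hr h4 (a := b) ha
          (by rw [swap_pow_of_mod_four_one h4, hu]; simp; linarith)]; ring
      · rw [eq_zero_of_mod_four_one hr h4 (a := a) hb (by rw [hu]; simpa using hcd)]; ring
    · rcases hab with ha | hb
      · have := eq_zero_of_mod_four_three hr h4 (a := -b) ha
          (by
            have h1 := swap_pow_of_mod_four_three h4 a (-b)
            rw [GaussianInt.conj_pow, hu] at h1
            rw [h1]; simp; linarith)
        rw [this]; ring
      · have := eq_zero_of_mod_four_three hr h4 (a := a) hb.neg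
          (by rw [GaussianInt.conj_pow, hu]; simpa using hcd)
        rw [neg_eq_zero.1 this]; ring
  have hbd : b ∣ d := by simpa [hu] using dvd_im_pow a b r
  have hcd0 : c * d = 0 := by
    rcases mul_eq_zero.1 key with h0 | h0
    · rw [h0, zero_dvd_iff] at hac
      rw [hac, zero_mul]
    · rw [h0, zero_dvd_iff] at hbd
      rw [hbd, mul_zero]
  linear_combination (c + d + 1) * hcd - 4 * hcd0

theorem factorial_dvd_two_pow_mul_prod (m k : ℕ) :
    k.factorial ∣ 2 ^ k * ∏ i ∈ Finset.range k, (4 * (m + i) + 5) := by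
  obtain ⟨e, o, ho, hk⟩ := Nat.exists_eq_two_pow_mul_odd (Nat.factorial_ne_zero k)
  have he : 2 ^ e ∣ 2 ^ k := by
    refine pow_dvd_pow 2 ?_
    have h1 : 2 ^ e ∣ k.factorial := ⟨o, hk⟩
    have h2 := (padicValNat_dvd_iff_le (Nat.factorial_ne_zero k)).1 h1
    have h3 := sub_one_mul_padicValNat_factorial (p := 2) k
    omega
  rw [hk]
  refine mul_dvd_mul he ?_
  have hcop : Nat.Coprime 4 o := by
    rw [show 4 = 2 ^ 2 by norm_num]
    exact Nat.Coprime.pow_left _ (Nat.coprime_two_left.2 ho)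
  obtain ⟨M, -, hM⟩ := Nat.exists_mul_mod_eq_of_coprime 1 hcop ho.pos.ne'
  have hmod : ∏ i ∈ Finset.range k, (4 * (m + i) + 5) ≡
      ∏ i ∈ Finset.range k, (4 * (m + 1 + M + i)) [MOD o] := by
    refine Nat.ModEq.prod fun i _ => ?_
    have hM' : 4 * M ≡ 1 [MOD o] := hM
    have := (hM'.add_left (4 * (m + 1 + i))).symm
    calc 4 * (m + i) + 5 = 4 * (m + 1 + i) + 1 := by ring
      _ ≡ 4 * (m + 1 + i) + 4 * M [MOD o] := this
      _ = 4 * (m + 1 + M + i) := by ring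
  have hdvd : o ∣ ∏ i ∈ Finset.range k, (4 * (m + 1 + M + i)) := by
    rw [Finset.prod_mul_distrib, ← Nat.ascFactorial_eq_prod_range]
    refine Dvd.dvd.mul_left ((Dvd.intro_left _ hk.symm).trans ?_) _
    exact Nat.factorial_dvd_ascFactorial _ _
  exact (hmod.dvd_iff dvd_rfl).2 hdvd

/-- The coefficient of `h ^ m` in the denominator of index `m + k` of the diagonal Padé
approximants to `(1 - z) ^ (1 / 4)`, scaled so as to be an integer. -/
def padeCoeff (m k : ℕ) : ℕ :=
  2 ^ k * (∏ i ∈ Finset.range k, (4 * (m + i) + 5)) / k.factorial * (2 * m + k).choose m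

theorem padeCoeff_mul_factorial (m k : ℕ) :
    (padeCoeff m k : ℚ) * (k.factorial * m.factorial * (m + k).factorial) =
      2 ^ k * (∏ i ∈ Finset.range k, (4 * (m + i) + 5 : ℚ)) * (2 * m + k).factorial := by
  have h1 := Nat.div_mul_cancel (factorial_dvd_two_pow_mul_prod m k)
  have h2 := Nat.choose_mul_factorial_mul_factorial (show m ≤ 2 * m + k by omega)
  rw [show 2 * m + k - m = m + k by omega] at h2
  unfold padeCoeff
  generalize 2 ^ k * (∏ i ∈ Finset.range k, (4 * (m + i) + 5)) / k.factorial = q at *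
  have h1' : (q : ℚ) * k.factorial = 2 ^ k * (∏ i ∈ Finset.range k, (4 * (m + i) + 5 : ℚ)) := by
    exact_mod_cast h1
  have h2' : ((2 * m + k).choose m : ℚ) * m.factorial * (m + k).factorial
      = (2 * m + k).factorial := by
    exact_mod_cast h2
  rw [← h1', ← h2']
  push_cast
  ring

theorem padeCoeff_succ_right (m k : ℕ) :
    (padeCoeff m (k + 1) : ℚ) * ((k + 1) * (m + k + 1)) =
      2 * (4 * (m + k) + 5) * (2 * m + k + 1) * padeCoeff m k := by
  have h1 := padeCoeff_mul_factorial m (k + 1)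
  have h2 := padeCoeff_mul_factorial m k
  rw [Finset.prod_range_succ, ← add_assoc, ← add_assoc, Nat.factorial_succ, Nat.factorial_succ,
    Nat.factorial_succ] at h1
  push_cast at h1
  have h3 : (k.factorial * m.factorial * (m + k).factorial : ℚ) ≠ 0 := by positivity
  apply mul_right_cancel₀ h3
  linear_combination h1 - 2 * (4 * (m + k) + 5) * (2 * m + k + 1) * h2

theorem padeCoeff_succ_left (m k : ℕ) :
    (padeCoeff (m + 1) k : ℚ) * (2 * (4 * m + 5) * (m + 1)) =
      (k + 1) * (2 * m + k + 2) * padeCoeff m (k + 1) := by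
  have h1 := padeCoeff_mul_factorial m (k + 1)
  have h2 := padeCoeff_mul_factorial (m + 1) k
  rw [Finset.prod_range_succ', ← add_assoc, ← add_assoc, Nat.factorial_succ k] at h1
  rw [show m + 1 + k = m + k + 1 by ring, show 2 * (m + 1) + k = 2 * m + k + 1 + 1 by ring,
    Nat.factorial_succ m, Nat.factorial_succ (2 * m + k + 1)] at h2
  have hprod : ∏ i ∈ Finset.range k, (4 * (((m + 1 : ℕ) : ℚ) + i) + 5) =
      ∏ i ∈ Finset.range k, (4 * ((m : ℚ) + ((i + 1 : ℕ) : ℚ)) + 5) :=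
    Finset.prod_congr rfl fun i _ => by push_cast; ring
  rw [hprod] at h2
  generalize ∏ i ∈ Finset.range k, (4 * ((m : ℚ) + ((i + 1 : ℕ) : ℚ)) + 5) = p at *
  push_cast at h1 h2
  have h3 : (k.factorial * m.factorial * (m + k + 1).factorial : ℚ) ≠ 0 := by positivity
  apply mul_right_cancel₀ h3
  linear_combination 2 * (4 * m + 5) * h2 - (2 * m + k + 2) * h1

/-- Polynomial in `h` with coefficients `padeCoeff`. -/
def padeDenom {R : Type*} [CommRing R] (h : R) (n : ℕ) : R :=
  ∑ m ∈ Finset.range (n + 1), (padeCoeff m (n - m) : R) * h ^ m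

theorem padeCoeff_zero_right_succ (m : ℕ) :
    (padeCoeff (m + 1) 0 : ℚ) * (m + 1) = 2 * (2 * m + 1) * padeCoeff m 0 := by
  have h1 := padeCoeff_succ_left m 0
  have h2 := padeCoeff_succ_right m 0
  push_cast at h1 h2
  have h3 : (2 * (4 * m + 5) * (m + 1) : ℚ) ≠ 0 := by positivity
  apply mul_right_cancel₀ h3
  linear_combination (m + 1) * h1 + (2 * m + 2) * h2

theorem padeCoeff_rec (m k : ℕ) :
    ((m + k + 3) * (m + k + 2) * padeCoeff (m + 1) (k + 2) : ℤ) =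
      2 * (m + k + 2) * (2 * (m + k) + 5) * (padeCoeff m (k + 2) + 4 * padeCoeff (m + 1) (k + 1))
      - 4 * (4 * (m + k) + 7) * (4 * (m + k) + 9) * padeCoeff (m + 1) k := by
  have h1 := padeCoeff_succ_right (m + 1) k
  have h2 := padeCoeff_succ_right (m + 1) (k + 1)
  have h3 := padeCoeff_succ_left m (k + 1)
  have key : ((m + k + 3) * (m + k + 2) * padeCoeff (m + 1) (k + 2) : ℚ) =
      2 * (m + k + 2) * (2 * (m + k) + 5) * (padeCoeff m (k + 2) + 4 * padeCoeff (m + 1) (k + 1))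
      - 4 * (4 * (m + k) + 7) * (4 * (m + k) + 9) * padeCoeff (m + 1) k := by
    push_cast at h1 h2 h3
    have h4 : ((k + 2) * (2 * m + k + 3) : ℚ) ≠ 0 := by positivity
    apply mul_left_cancel₀ h4
    linear_combination (m + k + 2) * (2 * m + k + 3) * h2
      + 2 * (m + k + 2) * (2 * (m + k) + 5) * h3 - 2 * (4 * (m + k) + 7) * (k + 2) * h1
  exact_mod_cast key

theorem padeCoeff_rec_right_one (m : ℕ) :
    ((m + 2) * (m + 1) * padeCoeff (m + 1) 1 : ℤ) =
      2 * (m + 1) * (2 * m + 3) * (padeCoeff m 1 + 4 * padeCoeff (m + 1) 0) := by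
  have h2 := padeCoeff_succ_right (m + 1) 0
  have h3 := padeCoeff_succ_left m 0
  have key : ((m + 2) * (m + 1) * padeCoeff (m + 1) 1 : ℚ) =
      2 * (m + 1) * (2 * m + 3) * (padeCoeff m 1 + 4 * padeCoeff (m + 1) 0) := by
    push_cast at h2 h3
    linear_combination (m + 1) * h2 + (2 * m + 3) * h3
  exact_mod_cast key

theorem padeCoeff_rec_right_zero (m : ℕ) :
    ((m + 2) * (m + 1) * padeCoeff (m + 2) 0 : ℤ) =
      2 * (m + 1) * (2 * m + 3) * padeCoeff (m + 1) 0 := by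
  have h1 := padeCoeff_zero_right_succ (m + 1)
  have key : ((m + 2) * (m + 1) * padeCoeff (m + 2) 0 : ℚ) =
      2 * (m + 1) * (2 * m + 3) * padeCoeff (m + 1) 0 := by
    push_cast at h1
    linear_combination (m + 1) * h1
  exact_mod_cast key

theorem padeCoeff_rec_left_zero (n : ℕ) :
    ((n + 2) * (n + 1) * padeCoeff 0 (n + 2) : ℤ) =
      8 * (n + 1) * (2 * n + 3) * padeCoeff 0 (n + 1)
      - 4 * (4 * n + 3) * (4 * n + 5) * padeCoeff 0 n := by
  have h1 := padeCoeff_succ_right 0 n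
  have h2 := padeCoeff_succ_right 0 (n + 1)
  have key : ((n + 2) * (n + 1) * padeCoeff 0 (n + 2) : ℚ) =
      8 * (n + 1) * (2 * n + 3) * padeCoeff 0 (n + 1)
      - 4 * (4 * n + 3) * (4 * n + 5) * padeCoeff 0 n := by
    push_cast at h1 h2
    have h4 : ((n + 1) * (n + 2) : ℚ) ≠ 0 := by positivity
    apply mul_left_cancel₀ h4
    linear_combination (n + 1) * (n + 1) * h2 - 2 * (n + 2) * (4 * n + 3) * h1
  exact_mod_cast key

/-- The coefficient of `h ^ m` in `padeDenom h n`. -/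
def padeDenomCoeff (n m : ℕ) : ℕ := if m ≤ n then padeCoeff m (n - m) else 0

theorem padeDenom_eq_sum {R : Type*} [CommRing R] (h : R) {n N : ℕ} (hn : n < N) :
    padeDenom h n = ∑ m ∈ Finset.range N, (padeDenomCoeff n m : R) * h ^ m := by
  unfold padeDenom
  rw [← Finset.sum_subset (Finset.range_subset_range.2 (show n + 1 ≤ N from hn))]
  · refine Finset.sum_congr rfl fun m hm => ?_
    rw [padeDenomCoeff, if_pos (by simpa [Nat.lt_succ_iff] using hm)]
  · intro m _ hm
    rw [padeDenomCoeff, if_neg (by simpa [Nat.lt_succ_iff] using hm)]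
    simp

theorem padeDenomCoeff_rec (n m : ℕ) :
    ((n + 2) * (n + 1) * padeDenomCoeff (n + 2) (m + 1) : ℤ) =
      2 * (n + 1) * (2 * n + 3) * (padeDenomCoeff (n + 1) m + 4 * padeDenomCoeff (n + 1) (m + 1))
      - 4 * (4 * n + 3) * (4 * n + 5) * padeDenomCoeff n (m + 1) := by
  unfold padeDenomCoeff
  rcases lt_trichotomy (m + 1) (n + 1) with h | h | h
  · obtain ⟨k, rfl⟩ : ∃ k, n = m + k + 1 := ⟨n - m - 1, by omega⟩
    rw [if_pos (by omega), if_pos (by omega), if_pos (by omega), if_pos (by omega)]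
    rw [show m + k + 1 + 2 - (m + 1) = k + 2 by omega, show m + k + 1 + 1 - m = k + 2 by omega,
      show m + k + 1 + 1 - (m + 1) = k + 1 by omega, show m + k + 1 - (m + 1) = k by omega]
    have := padeCoeff_rec m k
    push_cast
    linear_combination this
  · obtain rfl : m = n := by omega
    rw [if_pos (by omega), if_pos (by omega), if_pos (by omega), if_neg (by omega)]
    rw [show m + 2 - (m + 1) = 1 by omega, show m + 1 - m = 1 by omega, Nat.sub_self]
    have := padeCoeff_rec_right_one m
    push_cast
    linear_combination this
  · rcases Nat.lt_or_ge (n + 2) (m + 1) with h' | h'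
    · rw [if_neg (by omega), if_neg (by omega), if_neg (by omega), if_neg (by omega)]
      simp
    · obtain rfl : m = n + 1 := by omega
      rw [if_pos (by omega), if_pos (by omega), if_neg (by omega), if_neg (by omega)]
      rw [show n + 2 - (n + 1 + 1) = 0 by omega, Nat.sub_self]
      have := padeCoeff_rec_right_zero n
      push_cast
      linear_combination this

theorem padeDenom_rec {R : Type*} [CommRing R] (h : R) (n : ℕ) :
    ((n + 2) * (n + 1) : R) * padeDenom h (n + 2) =
      2 * (h + 4) * (n + 1) * (2 * n + 3) * padeDenom h (n + 1)
      - 4 * (4 * n + 3) * (4 * n + 5) * padeDenom h n := by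
  rw [padeDenom_eq_sum h (show n + 2 < n + 3 by omega),
    padeDenom_eq_sum h (show n < n + 3 by omega),
    Finset.sum_range_succ' (fun m => (padeDenomCoeff (n + 2) m : R) * h ^ m),
    Finset.sum_range_succ' (fun m => (padeDenomCoeff n m : R) * h ^ m)]
  have e1 : 2 * (h + 4) * (n + 1) * (2 * n + 3) * padeDenom h (n + 1) =
      2 * (n + 1) * (2 * n + 3) *
        (h * ∑ m ∈ Finset.range (n + 2), (padeDenomCoeff (n + 1) m : R) * h ^ m)
      + 8 * (n + 1) * (2 * n + 3) * (∑ m ∈ Finset.range (n + 2),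
        (padeDenomCoeff (n + 1) (m + 1) : R) * h ^ (m + 1)
        + (padeDenomCoeff (n + 1) 0 : R) * h ^ 0) := by
    rw [← Finset.sum_range_succ' (fun m => (padeDenomCoeff (n + 1) m : R) * h ^ m),
      ← padeDenom_eq_sum h (show n + 1 < n + 2 by omega),
      ← padeDenom_eq_sum h (show n + 1 < n + 2 + 1 by omega)]
    ring
  rw [e1]
  have hs : ((n + 2) * (n + 1) : R) *
      ∑ m ∈ Finset.range (n + 2), (padeDenomCoeff (n + 2) (m + 1) : R) * h ^ (m + 1) =
      2 * (n + 1) * (2 * n + 3) *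
        (h * ∑ m ∈ Finset.range (n + 2), (padeDenomCoeff (n + 1) m : R) * h ^ m)
      + 8 * (n + 1) * (2 * n + 3) * (∑ m ∈ Finset.range (n + 2),
        (padeDenomCoeff (n + 1) (m + 1) : R) * h ^ (m + 1))
      - 4 * (4 * n + 3) * (4 * n + 5) * (∑ m ∈ Finset.range (n + 2),
        (padeDenomCoeff n (m + 1) : R) * h ^ (m + 1)) := by
    simp only [Finset.mul_sum, ← Finset.sum_add_distrib, ← Finset.sum_sub_distrib]
    refine Finset.sum_congr rfl fun m _ => ?_
    have h1 := congrArg (Int.cast : ℤ → R) (padeDenomCoeff_rec n m)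
    push_cast at h1
    rw [pow_succ]
    linear_combination h ^ m * h * h1
  have h0 := congrArg (Int.cast : ℤ → R) (padeCoeff_rec_left_zero n)
  push_cast at h0
  simp only [padeDenomCoeff, Nat.zero_le, if_true, Nat.sub_zero] at hs ⊢
  linear_combination hs + h0

theorem padeDenom_zero {R : Type*} [CommRing R] (h : R) : padeDenom h 0 = 1 := by
  simp [padeDenom, padeCoeff]

theorem padeDenom_one {R : Type*} [CommRing R] (h : R) : padeDenom h 1 = 2 * h + 10 := by
  simp [padeDenom, padeCoeff, Finset.sum_range_succ]
  ring

/-- Integer solutions of the three-term recurrence attached to `arctan (1 / 239)`. -/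
theorem exists_int_pade_seq : ∃ U V : ℕ → ℤ, U 0 = 1 ∧ U 1 = 1912 ∧ V 0 = 0 ∧ V 1 = 2 ∧
    (∀ n : ℕ, (n + 2) * (n + 1) * U (n + 2) = 1912 * (n + 1) * (2 * n + 3) * U (n + 1)
      + 4 * (4 * n + 3) * (4 * n + 5) * U n) ∧
    (∀ n : ℕ, (n + 2) * (n + 1) * V (n + 2) = 1912 * (n + 1) * (2 * n + 3) * V (n + 1)
      + 4 * (4 * n + 3) * (4 * n + 5) * V n) := by
  let H : ℕ → GaussianInt := fun n => ⟨0, 1⟩ ^ n * padeDenom ⟨-4, -956⟩ n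
  have hI : (⟨0, 1⟩ : GaussianInt) ^ 2 = -1 := by decide
  have hrec : ∀ n : ℕ, ((n + 2) * (n + 1) : GaussianInt) * H (n + 2) =
      1912 * (n + 1) * (2 * n + 3) * H (n + 1) + 4 * (4 * n + 3) * (4 * n + 5) * H n := by
    intro n
    have h1 := padeDenom_rec (⟨-4, -956⟩ : GaussianInt) n
    have h2 : -(2 * ((⟨-4, -956⟩ : GaussianInt) + 4)) = 1912 * ⟨0, 1⟩ := by decide
    simp only [H]
    rw [pow_add, hI, pow_succ]
    linear_combination (-1) * (⟨0, 1⟩ : GaussianInt) ^ n * h1 + (⟨0, 1⟩ : GaussianInt) ^ n *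
      (n + 1) * (2 * n + 3) * padeDenom ⟨-4, -956⟩ (n + 1) * h2
  have hcast : ∀ n : ℕ, ((((n + 2) * (n + 1) : ℤ) : GaussianInt)) * H (n + 2) =
      ((1912 * (n + 1) * (2 * n + 3) : ℤ) : GaussianInt) * H (n + 1)
      + ((4 * (4 * n + 3) * (4 * n + 5) : ℤ) : GaussianInt) * H n := by
    intro n
    push_cast
    exact hrec n
  have h0 : H 0 = 1 := by simp [H, padeDenom_zero]
  have h1 : H 1 = ⟨1912, 2⟩ := by
    simp only [H, padeDenom_one, pow_one]
    decide
  refine ⟨fun n => (H n).re, fun n => (H n).im, by simp [h0], by simp [h1], by simp [h0],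
    by simp [h1], fun n => ?_, fun n => ?_⟩
  · have := congrArg Zsqrtd.re (hcast n)
    simpa only [Zsqrtd.re_add, Zsqrtd.re_smul] using this
  · have := congrArg Zsqrtd.im (hcast n)
    simpa only [Zsqrtd.im_add, Zsqrtd.im_smul] using this

/-- The integral of `(2 cos t - 2 cos a) ^ n cos (ν t)` over `[-a, a]`. -/
noncomputable def cosInt (a ν : ℝ) (n : ℕ) : ℝ :=
  ∫ t in (-a)..a, (2 * Real.cos t - 2 * Real.cos a) ^ n * Real.cos (ν * t)

theorem cosInt_zero (a : ℝ) {ν : ℝ} (hν : ν ≠ 0) :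
    cosInt a ν 0 = 2 * Real.sin (ν * a) / ν := by
  have h : ∀ t ∈ Set.uIcc (-a) a,
      HasDerivAt (fun t => Real.sin (ν * t) / ν) ((2 * Real.cos t - 2 * Real.cos a) ^ 0 *
        Real.cos (ν * t)) t := fun t _ => by
    have := (((hasDerivAt_id t).const_mul ν).sin).div_const ν
    refine this.congr_deriv ?_
    simp only [id]
    field_simp
  rw [cosInt, intervalIntegral.integral_eq_sub_of_hasDerivAt h
    (Continuous.intervalIntegrable (by fun_prop) _ _), mul_neg, Real.sin_neg]
  ring

theorem cosInt_one (a ν : ℝ) :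
    (1 - ν ^ 2) * cosInt a ν 1 =
      4 * Real.sin a * Real.cos (ν * a) - 2 * Real.cos a * cosInt a ν 0 := by
  have h : ∀ t ∈ Set.uIcc (-a) a,
      HasDerivAt (fun t => -2 * Real.sin t * Real.cos (ν * t) +
        ν * ((2 * Real.cos t - 2 * Real.cos a) * Real.sin (ν * t)))
      (-(1 - ν ^ 2) * ((2 * Real.cos t - 2 * Real.cos a) ^ 1 * Real.cos (ν * t))
        - 2 * Real.cos a * ((2 * Real.cos t - 2 * Real.cos a) ^ 0 * Real.cos (ν * t))) t :=
      fun t _ => by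
    have hc := ((hasDerivAt_id t).const_mul ν).cos
    have hs := ((hasDerivAt_id t).const_mul ν).sin
    have hf := ((Real.hasDerivAt_cos t).const_mul 2).sub_const (2 * Real.cos a)
    have := (((Real.hasDerivAt_sin t).const_mul (-2)).mul hc).add ((hf.mul hs).const_mul ν)
    refine this.congr_deriv ?_
    simp only [id]
    ring
  have hi : ∀ n : ℕ, IntervalIntegrable
      (fun t => (2 * Real.cos t - 2 * Real.cos a) ^ n * Real.cos (ν * t))
      MeasureTheory.volume (-a) a := fun n => Continuous.intervalIntegrable (by fun_prop) _ _
  have key := intervalIntegral.integral_eq_sub_of_hasDerivAt h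
    (((hi 1).const_mul _).sub ((hi 0).const_mul _))
  rw [intervalIntegral.integral_sub ((hi 1).const_mul _) ((hi 0).const_mul _),
    intervalIntegral.integral_const_mul, intervalIntegral.integral_const_mul] at key
  simp only [Real.cos_neg, Real.sin_neg, mul_neg] at key
  unfold cosInt
  linear_combination (-1) * key

theorem cosInt_add_two (a ν : ℝ) (n : ℕ) :
    ((n + 2) ^ 2 - ν ^ 2) * cosInt a ν (n + 2) =
      -(n + 2) * (2 * n + 3) * (2 * Real.cos a) * cosInt a ν (n + 1)
      + (n + 2) * (n + 1) * (4 * Real.sin a ^ 2) * cosInt a ν n := by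
  have h : ∀ t ∈ Set.uIcc (-a) a,
      HasDerivAt (fun t => (n + 2) * (2 * Real.cos t - 2 * Real.cos a) ^ (n + 1) *
        (-2 * Real.sin t) * Real.cos (ν * t) +
        ν * ((2 * Real.cos t - 2 * Real.cos a) ^ (n + 2) * Real.sin (ν * t)))
      (-((n + 2) ^ 2 - ν ^ 2) *
          ((2 * Real.cos t - 2 * Real.cos a) ^ (n + 2) * Real.cos (ν * t))
        - (n + 2) * (2 * n + 3) * (2 * Real.cos a) *
          ((2 * Real.cos t - 2 * Real.cos a) ^ (n + 1) * Real.cos (ν * t))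
        + (n + 2) * (n + 1) * (4 * Real.sin a ^ 2) *
          ((2 * Real.cos t - 2 * Real.cos a) ^ n * Real.cos (ν * t))) t :=
      fun t _ => by
    have hc := ((hasDerivAt_id t).const_mul ν).cos
    have hs := ((hasDerivAt_id t).const_mul ν).sin
    have hf := ((Real.hasDerivAt_cos t).const_mul 2).sub_const (2 * Real.cos a)
    have h1 := ((hf.pow (n + 1)).const_mul (n + 2 : ℝ)).mul
      ((Real.hasDerivAt_sin t).const_mul (-2))
    have := (h1.mul hc).add (((hf.pow (n + 2)).mul hs).const_mul ν)
    refine this.congr_deriv ?_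
    simp only [id, Nat.add_sub_cancel, show n + 2 - 1 = n + 1 by omega, Nat.cast_add,
      Nat.cast_one, Nat.cast_ofNat, Pi.pow_apply, Pi.mul_apply]
    have e1 := Real.sin_sq_add_cos_sq t
    have e2 := Real.sin_sq_add_cos_sq a
    linear_combination (n + 2) * (n + 1) * (2 * Real.cos t - 2 * Real.cos a) ^ n
      * Real.cos (ν * t) * 4 * (e1 - e2)
  have hi : ∀ n : ℕ, IntervalIntegrable
      (fun t => (2 * Real.cos t - 2 * Real.cos a) ^ n * Real.cos (ν * t))
      MeasureTheory.volume (-a) a := fun n => Continuous.intervalIntegrable (by fun_prop) _ _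
  have key := intervalIntegral.integral_eq_sub_of_hasDerivAt h
    ((((hi (n + 2)).const_mul _).sub ((hi (n + 1)).const_mul _)).add ((hi n).const_mul _))
  rw [intervalIntegral.integral_add (((hi (n + 2)).const_mul _).sub ((hi (n + 1)).const_mul _))
      ((hi n).const_mul _),
    intervalIntegral.integral_sub ((hi (n + 2)).const_mul _) ((hi (n + 1)).const_mul _),
    intervalIntegral.integral_const_mul, intervalIntegral.integral_const_mul,
    intervalIntegral.integral_const_mul] at key
  simp only [Real.cos_neg, Real.sin_neg, mul_neg, sub_self, zero_pow (Nat.succ_ne_zero _)] at key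
  unfold cosInt
  linear_combination (-1) * key

theorem cosInt_pos {a ν : ℝ} (ha : 0 < a) (ha' : a < 1) (hν : |ν| ≤ 1) (n : ℕ) :
    0 < cosInt a ν n := by
  refine intervalIntegral.intervalIntegral_pos_of_pos_on
    (Continuous.intervalIntegrable (by fun_prop) _ _) (fun t ht => ?_) (by linarith)
  have h1 : |t| < a := abs_lt.2 ht
  have h2 : Real.cos a < Real.cos t := by
    rw [← Real.cos_abs t]
    exact Real.cos_lt_cos_of_nonneg_of_le_pi (abs_nonneg t) (by linarith [Real.pi_gt_three]) h1
  have h3 : |ν * t| < 1 := by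
    rw [abs_mul]
    nlinarith [abs_nonneg ν, abs_nonneg t]
  have h4 : 0 < Real.cos (ν * t) := by
    have := abs_lt.1 h3
    exact Real.cos_pos_of_mem_Ioo ⟨by linarith [Real.pi_gt_three], by linarith [Real.pi_gt_three]⟩
  have h5 : 0 < 2 * Real.cos t - 2 * Real.cos a := by linarith
  positivity

theorem cosInt_le {a : ℝ} (ν : ℝ) (ha : 0 < a) (ha' : a < 1) (n : ℕ) :
    cosInt a ν n ≤ 2 * a * (2 - 2 * Real.cos a) ^ n := by
  have h := intervalIntegral.integral_mono_on (μ := MeasureTheory.volume) (a := -a) (b := a)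
    (f := fun t => (2 * Real.cos t - 2 * Real.cos a) ^ n * Real.cos (ν * t))
    (g := fun _ => (2 - 2 * Real.cos a) ^ n) (by linarith)
    (Continuous.intervalIntegrable (by fun_prop) _ _)
    (Continuous.intervalIntegrable (by fun_prop) _ _) (fun t ht => ?_)
  · rw [intervalIntegral.integral_const, smul_eq_mul] at h
    unfold cosInt
    linarith
  · have h1 : |t| ≤ a := abs_le.2 ht
    have h2 : Real.cos a ≤ Real.cos t := by
      rw [← Real.cos_abs t]
      exact Real.cos_le_cos_of_nonneg_of_le_pi (abs_nonneg t) (by linarith [Real.pi_gt_three]) h1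
    have h5 : 0 ≤ 2 * Real.cos t - 2 * Real.cos a := by linarith
    calc _ ≤ (2 * Real.cos t - 2 * Real.cos a) ^ n * 1 :=
          mul_le_mul_of_nonneg_left (Real.cos_le_one _) (by positivity)
      _ ≤ (2 - 2 * Real.cos a) ^ n := by
          rw [mul_one]
          exact pow_le_pow_left₀ h5 (by linarith [Real.cos_le_one t]) n

/-- The product of the `1 - 1 / (4 j) ^ 2` for `1 ≤ j ≤ n`. -/
noncomputable def quarterProd (n : ℕ) : ℝ :=
  ∏ j ∈ Finset.range n, (1 - 1 / (16 * ((j : ℝ) + 1) ^ 2))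

theorem quarterProd_factor_pos (j : ℕ) : (0 : ℝ) < 1 - 1 / (16 * ((j : ℝ) + 1) ^ 2) := by
  have : (0 : ℝ) ≤ j := j.cast_nonneg
  rw [sub_pos, div_lt_one (by positivity)]
  nlinarith

theorem quarterProd_pos (n : ℕ) : 0 < quarterProd n :=
  Finset.prod_pos fun j _ => quarterProd_factor_pos j

theorem quarterProd_le_one (n : ℕ) : quarterProd n ≤ 1 :=
  Finset.prod_le_one (fun j _ => (quarterProd_factor_pos j).le) fun j _ => by
    rw [sub_le_self_iff]
    positivity

theorem quarterProd_succ (n : ℕ) :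
    quarterProd (n + 1) * (16 * ((n : ℝ) + 1) ^ 2) =
      quarterProd n * ((4 * n + 3) * (4 * n + 5)) := by
  rw [quarterProd, Finset.prod_range_succ, ← quarterProd]
  field_simp
  ring

/-- The remainders of the Padé approximations, up to normalisation. -/
noncomputable def padeRem (a : ℝ) (n : ℕ) : ℝ :=
  1 / 8 * (-4 / Real.sin a) ^ n * (quarterProd n * cosInt a (1 / 4) n)

theorem padeRem_add_two {a : ℝ} (ha : Real.sin a ≠ 0) (n : ℕ) :
    (n + 2) * (n + 1) * padeRem a (n + 2) =
      8 * (Real.cos a / Real.sin a) * (n + 1) * (2 * n + 3) * padeRem a (n + 1)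
      + 4 * (4 * n + 3) * (4 * n + 5) * padeRem a n := by
  have h1 := cosInt_add_two a (1 / 4) n
  have h2 := quarterProd_succ n
  have h3 := quarterProd_succ (n + 1)
  push_cast at h3
  have hn : ((n : ℝ) + 2) ≠ 0 := by positivity
  have hn1 : ((n : ℝ) + 1) ≠ 0 := by positivity
  have h4 : ((n : ℝ) + 2) * (n + 1) * (quarterProd (n + 2) * cosInt a (1 / 4) (n + 2)) =
      -(n + 1) * (2 * n + 3) * (2 * Real.cos a) * (quarterProd (n + 1) * cosInt a (1 / 4) (n + 1))
      + (4 * n + 3) * (4 * n + 5) * (Real.sin a ^ 2 / 4) *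
        (quarterProd n * cosInt a (1 / 4) n) := by
    have hne : (16 * ((n : ℝ) + 2)) ≠ 0 := by positivity
    apply mul_left_cancel₀ hne
    linear_combination (n + 1) * cosInt a (1 / 4) (n + 2) * h3
      + 16 * (n + 1) * quarterProd (n + 1) * h1
      + 4 * (n + 2) * Real.sin a ^ 2 * cosInt a (1 / 4) n * h2
  unfold padeRem
  set s := Real.sin a
  have e2 : (-4 / s) ^ (n + 2) = (-4 / s) ^ n * (16 / s ^ 2) := by
    rw [pow_add]; congr 1; field_simp; norm_num
  have e1 : (-4 / s) ^ (n + 1) = (-4 / s) ^ n * (-4 / s) := pow_succ _ _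
  rw [e1, e2]
  generalize (-4 / s) ^ n = w
  generalize quarterProd (n + 2) * cosInt a (1 / 4) (n + 2) = j2 at *
  generalize quarterProd (n + 1) * cosInt a (1 / 4) (n + 1) = j1 at *
  generalize quarterProd n * cosInt a (1 / 4) n = j0 at *
  field_simp
  linear_combination 16 * w * h4

theorem padeRem_eq {a : ℝ} (ha : Real.sin a ≠ 0) {u v : ℕ → ℝ} (hu0 : u 0 = 1)
    (hu1 : u 1 = 8 * (Real.cos a / Real.sin a)) (hv0 : v 0 = 0) (hv1 : v 1 = 2)
    (hu : ∀ n : ℕ, (n + 2) * (n + 1) * u (n + 2) =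
      8 * (Real.cos a / Real.sin a) * (n + 1) * (2 * n + 3) * u (n + 1)
      + 4 * (4 * n + 3) * (4 * n + 5) * u n)
    (hv : ∀ n : ℕ, (n + 2) * (n + 1) * v (n + 2) =
      8 * (Real.cos a / Real.sin a) * (n + 1) * (2 * n + 3) * v (n + 1)
      + 4 * (4 * n + 3) * (4 * n + 5) * v n) (n : ℕ) :
    u n * Real.sin (a / 4) - v n * Real.cos (a / 4) = padeRem a n := by
  have h0 : padeRem a 0 = Real.sin (a / 4) := by
    rw [padeRem, cosInt_zero a (by norm_num : (1 / 4 : ℝ) ≠ 0), one_div_mul_eq_div]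
    simp [quarterProd]
    ring_nf
  have h1 : padeRem a 1 = 8 * (Real.cos a / Real.sin a) * Real.sin (a / 4)
      - 2 * Real.cos (a / 4) := by
    have h := cosInt_one a (1 / 4)
    rw [cosInt_zero a (by norm_num : (1 / 4 : ℝ) ≠ 0), one_div_mul_eq_div] at h
    have hq : quarterProd 1 = 1 - (1 / 4) ^ 2 := by simp [quarterProd]; norm_num
    rw [padeRem, hq, h]
    field_simp
    ring
  induction n using Nat.twoStepInduction with
  | zero => rw [hu0, hv0, h0]; ring
  | one => rw [hu1, hv1, h1]
  | more n ih1 ih2 =>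
    have hne : ((n : ℝ) + 2) * (n + 1) ≠ 0 := by positivity
    apply mul_left_cancel₀ hne
    rw [padeRem_add_two ha, ← ih1, ← ih2]
    linear_combination Real.sin (a / 4) * hu n - Real.cos (a / 4) * hv n

theorem neg_one_pow_mul_padeRem (a : ℝ) (n : ℕ) :
    (-1) ^ n * padeRem a n =
      1 / 8 * (4 / Real.sin a) ^ n * (quarterProd n * cosInt a (1 / 4) n) := by
  rw [padeRem, neg_div, neg_pow (4 / Real.sin a)]
  have : ((-1 : ℝ) ^ n) * (-1) ^ n = 1 := by rw [← mul_pow]; simp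
  linear_combination 1 / 8 * (4 / Real.sin a) ^ n * (quarterProd n * cosInt a (1 / 4) n) * this

theorem neg_one_pow_mul_padeRem_pos {a : ℝ} (ha : 0 < a) (ha' : a < 1) (n : ℕ) :
    0 < (-1) ^ n * padeRem a n := by
  have hs : 0 < Real.sin a :=
    Real.sin_pos_of_pos_of_lt_pi ha (by linarith [Real.pi_gt_three])
  have h1 := cosInt_pos ha ha' (ν := 1 / 4) (by rw [abs_of_pos] <;> norm_num) n
  have h2 := quarterProd_pos n
  rw [neg_one_pow_mul_padeRem]
  positivity

theorem abs_padeRem_le {a : ℝ} (ha : 0 < a) (ha' : a < 1) (n : ℕ) :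
    |padeRem a n| ≤ a / 4 * (8 * (1 - Real.cos a) / Real.sin a) ^ n := by
  have hs : 0 < Real.sin a :=
    Real.sin_pos_of_pos_of_lt_pi ha (by linarith [Real.pi_gt_three])
  have habs : |padeRem a n| = (-1) ^ n * padeRem a n := by
    rw [← abs_of_pos (neg_one_pow_mul_padeRem_pos ha ha' n), abs_mul, abs_neg_one_pow, one_mul]
  rw [habs, neg_one_pow_mul_padeRem]
  have h0 := quarterProd_pos n
  calc 1 / 8 * (4 / Real.sin a) ^ n * (quarterProd n * cosInt a (1 / 4) n)
      ≤ 1 / 8 * (4 / Real.sin a) ^ n * (1 * (2 * a * (2 - 2 * Real.cos a) ^ n)) := by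
        have := cosInt_le (1 / 4) ha ha' n
        have := quarterProd_le_one n
        have : 0 ≤ cosInt a (1 / 4) n :=
          (cosInt_pos ha ha' (ν := 1 / 4) (by rw [abs_of_pos] <;> norm_num) n).le
        gcongr
    _ = a / 4 * (8 * (1 - Real.cos a) / Real.sin a) ^ n := by
        rw [show 8 * (1 - Real.cos a) / Real.sin a = 4 / Real.sin a * (2 - 2 * Real.cos a) by ring,
          mul_pow]
        ring

theorem pade_seq_nonneg {u : ℕ → ℤ} (h0 : 0 ≤ u 0) (h1 : 0 ≤ u 1)
    (hu : ∀ n : ℕ, (n + 2) * (n + 1) * u (n + 2) = 1912 * (n + 1) * (2 * n + 3) * u (n + 1)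
      + 4 * (4 * n + 3) * (4 * n + 5) * u n) (n : ℕ) : 0 ≤ u n := by
  induction n using Nat.twoStepInduction with
  | zero => exact h0
  | one => exact h1
  | more n ih1 ih2 =>
    have h : (0 : ℤ) < (n + 2) * (n + 1) := by positivity
    refine nonneg_of_mul_nonneg_right ?_ h
    rw [hu]
    positivity

theorem pade_seq_pos {u : ℕ → ℤ} (h0 : 0 < u 0) (h1 : 0 < u 1)
    (hu : ∀ n : ℕ, (n + 2) * (n + 1) * u (n + 2) = 1912 * (n + 1) * (2 * n + 3) * u (n + 1)
      + 4 * (4 * n + 3) * (4 * n + 5) * u n) (n : ℕ) : 0 < u n := by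
  induction n using Nat.twoStepInduction with
  | zero => exact h0
  | one => exact h1
  | more n ih1 ih2 =>
    have h : (0 : ℤ) < (n + 2) * (n + 1) := by positivity
    have h' : 0 < ((n + 2) * (n + 1) : ℤ) * u (n + 2) := by
      rw [hu]
      positivity
    exact (mul_pos_iff_of_pos_left h).1 h'

theorem pade_seq_le {u : ℕ → ℤ} (h0 : 0 ≤ u 0) (h1 : 0 ≤ u 1) (h0' : u 0 ≤ 1) (h1' : u 1 ≤ 3825)
    (hu : ∀ n : ℕ, (n + 2) * (n + 1) * u (n + 2) = 1912 * (n + 1) * (2 * n + 3) * u (n + 1)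
      + 4 * (4 * n + 3) * (4 * n + 5) * u n) (n : ℕ) : u n ≤ 3825 ^ n := by
  induction n using Nat.twoStepInduction with
  | zero => simpa using h0'
  | one => simpa using h1'
  | more n ih1 ih2 =>
    have p0 := pade_seq_nonneg h0 h1 hu n
    have p1 := pade_seq_nonneg h0 h1 hu (n + 1)
    have h : (0 : ℤ) < (n + 2) * (n + 1) := by positivity
    refine le_of_mul_le_mul_left ?_ h
    rw [hu]
    have e0 : (4 * (4 * n + 3) * (4 * n + 5) : ℤ) * u n ≤ 64 * ((n + 2) * (n + 1)) * 3825 ^ n :=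
      mul_le_mul (by nlinarith) ih1 p0 (by positivity)
    have e1 : (1912 * (n + 1) * (2 * n + 3) : ℤ) * u (n + 1) ≤
        3824 * ((n + 2) * (n + 1)) * 3825 ^ (n + 1) :=
      mul_le_mul (by nlinarith) ih2 p1 (by positivity)
    have e2 : (0 : ℤ) ≤ (n + 2) * (n + 1) * 3825 ^ n := by positivity
    rw [pow_succ] at e1
    rw [pow_succ, pow_succ]
    nlinarith

theorem exists_pade_approx : ∃ (U V : ℕ → ℤ) (s c S : ℝ), s ^ 2 + c ^ 2 = 1 ∧ 0 < s ∧ 0 < c ∧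
    0 < S ∧ 57122 * S ^ 2 = 1 ∧ c ^ 4 - 6 * c ^ 2 * s ^ 2 + s ^ 4 = 239 * S ∧
    4 * c * s * (c ^ 2 - s ^ 2) = S ∧ ∀ n, 0 < U n ∧ 0 ≤ V n ∧ V n ≤ U n ∧ U n ≤ 3825 ^ n ∧
      0 < (-1) ^ n * (U n * s - V n * c) ∧ |U n * s - V n * c| ≤ 1 / 956 * (4 / 239) ^ n := by
  obtain ⟨U, V, hU0, hU1, hV0, hV1, hU, hV⟩ := exists_int_pade_seq
  set a := Real.arctan (1 / 239) with ha_def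
  have htan : Real.tan a = 1 / 239 := Real.tan_arctan _
  have hcpos : 0 < Real.cos a := Real.cos_arctan_pos _
  have ha : 0 < a := Real.arctan_pos.2 (by norm_num)
  have ha' : a < 1 / 239 := by
    rw [← htan]
    exact Real.lt_tan ha (Real.arctan_lt_pi_div_two _)
  have hcs : Real.cos a = 239 * Real.sin a := by
    rw [Real.tan_eq_sin_div_cos, div_eq_iff hcpos.ne'] at htan
    linarith
  have hs : 0 < Real.sin a := by linarith
  have hS : 57122 * Real.sin a ^ 2 = 1 := by
    have := Real.sin_sq_add_cos_sq a
    rw [hcs] at this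
    linarith
  have ha4 : a = 2 * (2 * (a / 4)) := by ring
  have hpi := Real.pi_gt_three
  have hcs4 := Real.sin_sq_add_cos_sq (a / 4)
  have hs4 : 0 < Real.sin (a / 4) := Real.sin_pos_of_pos_of_lt_pi (by linarith) (by linarith)
  have hc4 : 0 < Real.cos (a / 4) := Real.cos_pos_of_mem_Ioo ⟨by linarith, by linarith⟩
  have h239 : 8 * (Real.cos a / Real.sin a) = 1912 := by
    rw [hcs]
    field_simp
    norm_num
  have hrem : ∀ n, U n * Real.sin (a / 4) - V n * Real.cos (a / 4) = padeRem a n := by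
    refine padeRem_eq hs.ne' (u := fun n => (U n : ℝ)) (v := fun n => (V n : ℝ)) (by simp [hU0])
      (by rw [h239, hU1]; norm_num) (by simp [hV0]) (by simp [hV1]) (fun n => ?_) fun n => ?_
    · rw [h239]
      exact_mod_cast hU n
    · rw [h239]
      exact_mod_cast hV n
  refine ⟨U, V, Real.sin (a / 4), Real.cos (a / 4), Real.sin a, hcs4, hs4, hc4, hs, hS, ?_, ?_,
    fun n => ⟨?_, ?_, ?_, ?_, ?_, ?_⟩⟩
  · rw [← hcs]
    conv_rhs => rw [ha4, Real.cos_two_mul, Real.cos_two_mul]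
    linear_combination (Real.sin (a / 4) ^ 2 + 1 - 7 * Real.cos (a / 4) ^ 2) * hcs4
  · conv_rhs => rw [ha4, Real.sin_two_mul, Real.sin_two_mul, Real.cos_two_mul]
    linear_combination (-4) * Real.cos (a / 4) * Real.sin (a / 4) * hcs4
  · exact pade_seq_pos (by omega) (by omega) hU n
  · exact pade_seq_nonneg (by omega) (by omega) hV n
  · have := pade_seq_nonneg (u := fun n => U n - V n) (by simp [hU0, hV0]) (by simp [hU1, hV1])
      (fun n => by linear_combination hU n - hV n) n
    simpa using this
  · exact pade_seq_le (by omega) (by omega) (by omega) (by omega) hU n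
  · rw [hrem]
    exact neg_one_pow_mul_padeRem_pos ha (by linarith) n
  · rw [hrem]
    refine (abs_padeRem_le ha (by linarith) n).trans ?_
    have h1 : 0 ≤ 8 * (1 - Real.cos a) / Real.sin a :=
      div_nonneg (by linarith [Real.cos_le_one a]) hs.le
    have h2 : 8 * (1 - Real.cos a) / Real.sin a ≤ 4 / 239 := by
      rw [div_le_iff₀ hs, hcs]
      have : (478 : ℝ) ≤ 114243 * Real.sin a :=
        le_of_sq_le_sq (by nlinarith) (by positivity)
      linarith
    exact mul_le_mul (by linarith) (pow_le_pow_left₀ h1 h2 n) (by positivity) (by norm_num)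

theorem add_sq_pow_three_le {p q : ℤ} (h : p * q * (p ^ 2 - q ^ 2) ≠ 0) :
    (p ^ 2 + q ^ 2) ^ 3 ≤ 32 * (p * q * (p ^ 2 - q ^ 2)) ^ 2 := by
  have main : ∀ m M : ℤ, 0 < m → m < M →
      (M ^ 2 + m ^ 2) ^ 3 ≤ 32 * (M * m * (M ^ 2 - m ^ 2)) ^ 2 := by
    intro m M hm hM
    have h1 : M ^ 2 ≤ 2 * (m * (M - m) * (M + m)) := by
      have h0 : M - 1 ≤ m * (M - m) := by nlinarith
      have h0' : (M - 1) * (M + 1) ≤ m * (M - m) * (M + m) :=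
        mul_le_mul h0 (by omega) (by omega) (by nlinarith)
      nlinarith
    have h2 : M ^ 3 ≤ 2 * (M * m * (M ^ 2 - m ^ 2)) := by
      linarith only [mul_le_mul_of_nonneg_left h1 (hm.trans hM).le]
    have h3 : (M ^ 3) ^ 2 ≤ (2 * (M * m * (M ^ 2 - m ^ 2))) ^ 2 :=
      pow_le_pow_left₀ (by have : 0 < M := by omega
                           positivity) h2 2
    have h4 : (M ^ 2 + m ^ 2) ^ 3 ≤ (2 * M ^ 2) ^ 3 :=
      pow_le_pow_left₀ (by positivity) (by nlinarith) 3
    linarith only [h3, h4]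
  have hp : p ≠ 0 := by rintro rfl; simp at h
  have hq : q ≠ 0 := by rintro rfl; simp at h
  rcases lt_trichotomy |p| |q| with hlt | heq | hlt
  · have := main |p| |q| (abs_pos.2 hp) hlt
    simp only [sq_abs] at this
    calc _ = (q ^ 2 + p ^ 2) ^ 3 := by ring
      _ ≤ _ := this
      _ = 32 * (|p| ^ 2 * |q| ^ 2 * (p ^ 2 - q ^ 2) ^ 2) := by ring
      _ = _ := by simp only [sq_abs]; ring
  · exact absurd (by rw [(sq_eq_sq_iff_abs_eq_abs p q).2 heq]; ring) h
  · have := main |q| |p| (abs_pos.2 hq) hlt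
    simp only [sq_abs] at this
    calc _ ≤ _ := this
      _ = 32 * (|p| ^ 2 * |q| ^ 2 * (p ^ 2 - q ^ 2) ^ 2) := by ring
      _ = _ := by simp only [sq_abs]; ring

theorem two_mul_pow_four_eq {a b X U V p q : ℤ} {s c S : ℝ} (hsc : s ^ 2 + c ^ 2 = 1)
    (hre : c ^ 4 - 6 * c ^ 2 * s ^ 2 + s ^ 4 = 239 * S) (him : 4 * c * s * (c ^ 2 - s ^ 2) = S)
    (hz : (⟨1, 1⟩ : GaussianInt) * ⟨a, b⟩ ^ 4 = ⟨1, X⟩)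
    (hW : (⟨p, q⟩ : GaussianInt) = ⟨U, V⟩ * ⟨3, 2⟩ * ⟨a, b⟩) {r E : ℝ}
    (hr : r = U * c + V * s) (hE : E = V * c - U * s) :
    (2 : ℂ) * (p + q * Complex.I) ^ 4 =
      57122 * S * (r + E * Complex.I) ^ 4 * (Complex.I - X) := by
  have hI := Complex.I_sq
  have hz' := congrArg GaussianInt.toComplex hz
  have hW' := congrArg GaussianInt.toComplex hW
  simp only [map_mul, map_pow, GaussianInt.toComplex_def', Int.cast_one, Int.cast_ofNat,
    one_mul] at hz' hW'
  have hsc' : (s : ℂ) ^ 2 + c ^ 2 = 1 := by exact_mod_cast hsc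
  have hre' : (c : ℂ) ^ 4 - 6 * c ^ 2 * s ^ 2 + s ^ 4 = 239 * S := by exact_mod_cast hre
  have him' : 4 * (c : ℂ) * s * (c ^ 2 - s ^ 2) = S := by exact_mod_cast him
  have hθ : ((c : ℂ) + s * Complex.I) ^ 4 = S * (239 + Complex.I) := by
    linear_combination hre' + Complex.I * him' + (6 * (c : ℂ) ^ 2 * s ^ 2
      + 4 * c * s ^ 3 * Complex.I + s ^ 4 * (Complex.I ^ 2 - 1)) * hI
  have hζ : (U + V * Complex.I : ℂ) = (r + E * Complex.I) * (c + s * Complex.I) := by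
    rw [hr, hE]
    push_cast
    linear_combination (-(U + V * Complex.I : ℂ)) * hsc' - (V * c - U * s) * s * hI
  have h32 : (3 + 2 * Complex.I) ^ 4 = -119 + 120 * Complex.I := by
    linear_combination (216 + 96 * Complex.I + 16 * (Complex.I ^ 2 - 1)) * hI
  have h239 : (1 - Complex.I) * (239 + Complex.I) * (-119 + 120 * Complex.I)
      = 57122 * Complex.I := by
    linear_combination (-28441 - 120 * Complex.I) * hI
  rw [hW', hζ, mul_pow, mul_pow, mul_pow, hθ, h32]
  generalize (r + E * Complex.I : ℂ) ^ 4 = A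
  generalize (a + b * Complex.I : ℂ) ^ 4 = B at hz' ⊢
  have h2 : 2 * B = (1 - Complex.I) * (1 + X * Complex.I) := by
    linear_combination (1 - Complex.I) * hz' + B * hI
  calc 2 * (A * (S * (239 + Complex.I)) * (-119 + 120 * Complex.I) * B)
      = A * S * ((239 + Complex.I) * (-119 + 120 * Complex.I)) * (2 * B) := by ring
    _ = A * S * (1 + X * Complex.I) *
        ((1 - Complex.I) * (239 + Complex.I) * (-119 + 120 * Complex.I)) := by rw [h2]; ring
    _ = _ := by
        rw [h239]
        linear_combination A * S * 57122 * X * hI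

theorem Complex.add_mul_I_pow_four (u v : ℝ) : ((u : ℂ) + v * Complex.I) ^ 4 =
    ((u ^ 4 - 6 * u ^ 2 * v ^ 2 + v ^ 4 : ℝ) : ℂ) +
      ((4 * u * v * (u ^ 2 - v ^ 2) : ℝ) : ℂ) * Complex.I := by
  push_cast
  linear_combination (6 * (u : ℂ) ^ 2 * v ^ 2
    + 4 * u * v ^ 3 * Complex.I + v ^ 4 * (Complex.I ^ 2 - 1)) * Complex.I_sq

theorem quartic_form_identity {p q r E S X : ℝ}
    (h : (2 : ℂ) * (p + q * Complex.I) ^ 4 =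
      57122 * S * (r + E * Complex.I) ^ 4 * (Complex.I - X)) :
    8 * (p * q * (p ^ 2 - q ^ 2)) = 57122 * S *
      (r ^ 4 - 6 * r ^ 2 * E ^ 2 + E ^ 4 - X * (4 * r * E * (r ^ 2 - E ^ 2))) := by
  rw [Complex.add_mul_I_pow_four, Complex.add_mul_I_pow_four] at h
  have hB : 8 * (p * q * (p ^ 2 - q ^ 2)) = 2 * (4 * p * q * (p ^ 2 - q ^ 2)) := by ring
  rw [hB]
  generalize p ^ 4 - 6 * p ^ 2 * q ^ 2 + q ^ 4 = A at h
  generalize 4 * p * q * (p ^ 2 - q ^ 2) = B at h ⊢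
  generalize r ^ 4 - 6 * r ^ 2 * E ^ 2 + E ^ 4 = A' at h ⊢
  generalize 4 * r * E * (r ^ 2 - E ^ 2) = B' at h ⊢
  have him := congrArg Complex.im h
  simp at him
  linear_combination him

theorem not_of_real_bounds {r E h w X S N D t : ℝ} (hr0 : 0 < r) (hh0 : 0 < h) (hw : 0 < w)
    (hS : 0 < S) (hS' : 57122 * S ^ 2 = 1) (hrE : r ^ 2 + E ^ 2 = h ^ 2) (hh : 1 ≤ h)
    (hh1 : h ≤ 1.5 * D) (ht1 : t ≤ 1) (hEabs : |E| ≤ 1 / 956 * t)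
    (hXE : 0 < X * (-E)) (hXR : X ^ 2 + 1 = 2 * (w ^ 2) ^ 4) (hlow : 12 * D < w ^ 3)
    (hupp : w * t < 21)
    (hN : 8 * N = 57122 * S *
      (r ^ 4 - 6 * r ^ 2 * E ^ 2 + E ^ 4 - X * (4 * r * E * (r ^ 2 - E ^ 2))))
    (hN2 : N ≠ 0 → (13 * h ^ 2 * w ^ 2) ^ 3 ≤ 32 * N ^ 2) : False := by
  have hE956 : |E| ≤ 1 / 956 := by linarith only [hEabs, ht1]
  have hE2 : E ^ 2 ≤ (1 / 956) ^ 2 := sq_le_sq' (by linarith only [(abs_le.1 hE956).1])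
    (abs_le.1 hE956).2
  have hr2 : 0.9 < r ^ 2 := by nlinarith only [hrE, hE2, hh]
  have hXabs : |X| ≤ 1.42 * w ^ 4 := by
    refine abs_le_of_sq_le_sq ?_ (by positivity)
    have : 0 < w ^ 8 := by positivity
    linarith only [this, hXR]
  have hK : X * (-E) ≤ 1.42 * w ^ 3 * (21 / 956) := by
    calc X * (-E) ≤ |X * (-E)| := le_abs_self _
      _ = |X| * |E| := by rw [abs_mul, abs_neg]
      _ ≤ 1.42 * w ^ 4 * (1 / 956 * t) := by gcongr
      _ = 1.42 * w ^ 3 * (w * t / 956) := by ring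
      _ ≤ _ := by gcongr
  have hrE0 : 0 < r ^ 2 - E ^ 2 := by linarith only [hr2, hE2]
  have hrh : r ≤ h := le_of_sq_le_sq (by linarith only [hrE, sq_nonneg E]) hh0.le
  have hrh2 : r ^ 2 - E ^ 2 ≤ h ^ 2 := by linarith only [hrE, sq_nonneg E]
  have hR : 57122 * S ≤ 240 := le_of_sq_le_sq (by linarith only [hS']) (by norm_num)
  have hA : 0 < r ^ 4 - 6 * r ^ 2 * E ^ 2 + E ^ 4 := by
    have h1 : 0 < r ^ 2 * (r ^ 2 - 6 * E ^ 2) :=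
      mul_pos (by positivity) (by linarith only [hr2, hE2])
    have h2 : 0 ≤ E ^ 4 := by positivity
    linarith only [h1, h2]
  have hA' : r ^ 4 - 6 * r ^ 2 * E ^ 2 + E ^ 4 ≤ h ^ 4 := by
    have h1 : h ^ 4 = (r ^ 2 + E ^ 2) ^ 2 := by rw [hrE]; ring
    have h2 : 0 ≤ r ^ 2 * E ^ 2 := by positivity
    linarith only [h1, h2]
  have hB : 0 < X * (-E) * (r * (r ^ 2 - E ^ 2)) := mul_pos hXE (mul_pos hr0 hrE0)
  have hB' : X * (-E) * (r * (r ^ 2 - E ^ 2)) ≤ 1.42 * w ^ 3 * (21 / 956) * (h * h ^ 2) := by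
    gcongr
  have hNR : 8 * N = 57122 * S * (r ^ 4 - 6 * r ^ 2 * E ^ 2 + E ^ 4
      + 4 * (X * (-E) * (r * (r ^ 2 - E ^ 2)))) := by
    linear_combination hN
  have hN0 : 0 < N := by
    have : 0 < 57122 * S * (r ^ 4 - 6 * r ^ 2 * E ^ 2 + E ^ 4
      + 4 * (X * (-E) * (r * (r ^ 2 - E ^ 2)))) := by positivity
    rw [← hNR] at this
    exact (mul_pos_iff_of_pos_left (by norm_num)).1 this
  have hN1 : 8 * N ≤ 240 * (h ^ 4 + 4 * (1.42 * w ^ 3 * (21 / 956) * (h * h ^ 2))) := by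
    rw [hNR]
    gcongr
  replace hN2 := hN2 hN0.ne'
  have hN3 : 66 * (h ^ 3 * w ^ 3) ≤ 8 * N := by
    refine le_of_sq_le_sq ?_ (by positivity)
    have : 0 < h ^ 6 * w ^ 6 := by positivity
    linarith only [this, hN2]
  have hfin : h ^ 3 * (66 * w ^ 3) ≤ h ^ 3 * (240 * (h + 4 * (1.42 * w ^ 3 * (21 / 956)))) := by
    linarith only [hN1, hN3]
  have hlast := le_of_mul_le_mul_left hfin (by positivity)
  linarith only [hlast, hh1, hlow, pow_pos hw 3]

theorem not_of_pade_bounds {a b X U V : ℤ} {s c S w : ℝ} {n : ℕ} (hsc : s ^ 2 + c ^ 2 = 1)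
    (hs : 0 < s) (hc : 0 < c) (hS : 0 < S) (hS' : 57122 * S ^ 2 = 1)
    (hre : c ^ 4 - 6 * c ^ 2 * s ^ 2 + s ^ 4 = 239 * S) (him : 4 * c * s * (c ^ 2 - s ^ 2) = S)
    (hU : 0 < U) (hV : 0 ≤ V) (hVU : V ≤ U) (hUn : U ≤ 3825 ^ n)
    (hsgn : 0 < (-1) ^ n * (U * s - V * c))
    (hle : |U * s - V * c| ≤ 1 / 956 * (4 / 239) ^ n)
    (hz : (⟨1, 1⟩ : GaussianInt) * ⟨a, b⟩ ^ 4 = ⟨1, X⟩) (hX : X ^ 2 + 1 = 2 * (a ^ 2 + b ^ 2) ^ 4)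
    (hw : 0 < w) (hwy : w ^ 2 = a ^ 2 + b ^ 2) (hXn : 0 < (-1) ^ n * (X : ℝ))
    (hlow : 12 * 3825 ^ n < w ^ 3) (hupp : w * (4 / 239) ^ n < 21) : False := by
  obtain ⟨p, q, hW⟩ : ∃ p q : ℤ, (⟨p, q⟩ : GaussianInt) = ⟨U, V⟩ * ⟨3, 2⟩ * ⟨a, b⟩ := ⟨_, _, rfl⟩
  have hnorm : p ^ 2 + q ^ 2 = (U ^ 2 + V ^ 2) * 13 * (a ^ 2 + b ^ 2) := by
    have := congrArg Zsqrtd.norm hW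
    simp only [Zsqrtd.norm_mul] at this
    simp only [Zsqrtd.norm_def] at this
    linear_combination this
  obtain ⟨r, hr⟩ : ∃ r : ℝ, r = U * c + V * s := ⟨_, rfl⟩
  obtain ⟨E, hE⟩ : ∃ E : ℝ, E = V * c - U * s := ⟨_, rfl⟩
  have hkey := quartic_form_identity (p := p) (q := q) (X := X)
    (by exact_mod_cast two_mul_pow_four_eq hsc hre him hz hW hr hE)
  have hUR : (0 : ℝ) < U := by exact_mod_cast hU
  have hUR1 : (1 : ℝ) ≤ U := by exact_mod_cast hU
  have hVR : (0 : ℝ) ≤ V := by exact_mod_cast hV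
  have hVUR : (V : ℝ) ≤ U := by exact_mod_cast hVU
  have hUnR : (U : ℝ) ≤ 3825 ^ n := by exact_mod_cast hUn
  have hr0 : 0 < r := by rw [hr]; positivity
  have hrE : r ^ 2 + E ^ 2 = U ^ 2 + V ^ 2 := by
    rw [hr, hE]
    linear_combination (U ^ 2 + V ^ 2 : ℝ) * hsc
  obtain ⟨h, hh⟩ : ∃ h : ℝ, h = √(U ^ 2 + V ^ 2 : ℝ) := ⟨_, rfl⟩
  have hh2 : h ^ 2 = U ^ 2 + V ^ 2 := by rw [hh]; exact Real.sq_sqrt (by positivity)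
  have hh0 : 0 < h := by rw [hh]; positivity
  have hh1 : h ≤ 1.5 * 3825 ^ n := by
    have : h ≤ 1.5 * (U : ℝ) := le_of_sq_le_sq (by nlinarith) (by positivity)
    linarith
  have hEabs : |E| ≤ 1 / 956 * (4 / 239) ^ n := by
    rw [hE, abs_sub_comm]
    exact hle
  have hXE : 0 < X * (-E) := by
    have h2 := mul_pos hXn hsgn
    have h3 : ((-1 : ℝ) ^ n) * (-1) ^ n = 1 := by rw [← mul_pow]; simp
    have h4 : (X : ℝ) * (-E) = (-1) ^ n * X * ((-1) ^ n * (U * s - V * c)) := by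
      rw [hE]
      linear_combination (-(X * (U * s - V * c)) : ℝ) * h3
    rwa [h4]
  have hXR : (X : ℝ) ^ 2 + 1 = 2 * (w ^ 2) ^ 4 := by
    rw [hwy]
    exact_mod_cast hX
  refine not_of_real_bounds (N := p * q * (p ^ 2 - q ^ 2)) hr0 hh0 hw hS hS' (hrE.trans hh2.symm)
    (le_of_sq_le_sq (by nlinarith) hh0.le) hh1
    (pow_le_one₀ (by norm_num) (by norm_num)) hEabs hXE hXR hlow hupp hkey fun hne => ?_
  have h1 := add_sq_pow_three_le (p := p) (q := q) (by exact_mod_cast hne)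
  rw [hnorm] at h1
  have h2 : (((U : ℝ) ^ 2 + V ^ 2) * 13 * (a ^ 2 + b ^ 2)) ^ 3 ≤
      32 * (p * q * (p ^ 2 - q ^ 2) : ℝ) ^ 2 := by
    exact_mod_cast h1
  rw [← hwy, ← hh2] at h2
  linarith

theorem pow_lt_cube_of_le {w : ℝ} (hw : 3 * 10 ^ 8 ≤ w) {m : ℕ}
    (h : 21 ≤ w * (4 / 239) ^ m) : 12 * (3825 : ℝ) ^ (m + 2) < w ^ 3 := by
  have hw3 : (3 * 10 ^ 8 : ℝ) ^ 3 ≤ w ^ 3 := by gcongr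
  obtain hm | hm := le_or_gt m 2
  · have h4 : (3825 : ℝ) ^ (m + 2) ≤ 3825 ^ 4 := pow_le_pow_right₀ (by norm_num) (by omega)
    norm_num at h4 hw3 ⊢
    linarith
  · obtain ⟨k, rfl⟩ := Nat.exists_eq_add_of_le (Nat.succ_le_of_lt hm)
    have h1 : (21 : ℝ) ^ 3 ≤ w ^ 3 * ((4 / 239) ^ 3) ^ (3 + k) := by
      calc (21 : ℝ) ^ 3 ≤ (w * (4 / 239) ^ (3 + k)) ^ 3 := by gcongr
        _ = _ := by rw [mul_pow, ← pow_mul, ← pow_mul, mul_comm 3]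
    have h2 : (12 * 3825 ^ 2 : ℝ) * (3825 * (4 / 239) ^ 3) ^ (3 + k) < 21 ^ 3 := by
      have : ((3825 : ℝ) * (4 / 239) ^ 3) ^ (3 + k) ≤ (3825 * (4 / 239) ^ 3) ^ 3 :=
        pow_le_pow_of_le_one (by norm_num) (by norm_num) (by omega)
      calc _ ≤ (12 * 3825 ^ 2 : ℝ) * (3825 * (4 / 239) ^ 3) ^ 3 := by gcongr
        _ < 21 ^ 3 := by norm_num
    have hp : (0 : ℝ) < ((4 / 239) ^ 3) ^ (3 + k) := by positivity
    refine lt_of_mul_lt_mul_right (lt_of_eq_of_lt ?_ (h2.trans_le h1)) hp.le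
    rw [mul_pow (3825 : ℝ)]
    ring

theorem exists_index {w : ℝ} (hw : 3 * 10 ^ 8 ≤ w) (p : ℕ) (hp : p < 2) :
    ∃ k : ℕ, 12 * (3825 : ℝ) ^ (2 * k + p) < w ^ 3 ∧ w * (4 / 239) ^ (2 * k + p) < 21 := by
  classical
  have hw0 : 0 < w := by linarith
  have hex : ∃ k : ℕ, w * (4 / 239) ^ (2 * k + p) < 21 := by
    obtain ⟨k, hk⟩ := exists_pow_lt_of_lt_one (show (0 : ℝ) < 21 / w by positivity)
      (show (4 / 239 : ℝ) < 1 by norm_num)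
    refine ⟨k, ?_⟩
    rw [lt_div_iff₀ hw0] at hk
    have : (4 / 239 : ℝ) ^ (2 * k + p) ≤ (4 / 239) ^ k :=
      pow_le_pow_of_le_one (by norm_num) (by norm_num) (by omega)
    nlinarith
  refine ⟨Nat.find hex, ?_, Nat.find_spec hex⟩
  obtain h0 | h0 := Nat.eq_zero_or_pos (Nat.find hex)
  · rw [h0]
    have : (3825 : ℝ) ^ (2 * 0 + p) ≤ 3825 ^ 1 := pow_le_pow_right₀ (by norm_num) (by omega)
    have hw3 : (3 * 10 ^ 8 : ℝ) ^ 3 ≤ w ^ 3 := by gcongr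
    have : (12 * 3825 : ℝ) < (3 * 10 ^ 8) ^ 3 := by norm_num
    linarith
  · obtain ⟨k, hk⟩ := Nat.exists_eq_add_of_lt h0
    have hmin := Nat.find_min hex (show k < Nat.find hex by omega)
    have := pow_lt_cube_of_le hw (m := 2 * k + p) (not_lt.mp hmin)
    rw [hk]
    convert this using 3
    ring

/-- Large solutions of `(1 + i) (a + b i) ^ 4 = 1 + X i` do not exist. -/
theorem norm_lt_of_one_add_I_mul_pow_four {a b X : ℤ}
    (hz : (⟨1, 1⟩ : GaussianInt) * ⟨a, b⟩ ^ 4 = ⟨1, X⟩)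
    (hX : X ^ 2 + 1 = 2 * (a ^ 2 + b ^ 2) ^ 4) : a ^ 2 + b ^ 2 < 10 ^ 17 := by
  by_contra! hy
  obtain ⟨U, V, s, c, S, hsc, hs, hc, hS, hS', hre, him, hUV⟩ := exists_pade_approx
  have hyR : (10 ^ 17 : ℝ) ≤ (a : ℝ) ^ 2 + (b : ℝ) ^ 2 := by exact_mod_cast hy
  set w : ℝ := √((a : ℝ) ^ 2 + (b : ℝ) ^ 2) with hwdef
  have hwy : w ^ 2 = (a : ℝ) ^ 2 + (b : ℝ) ^ 2 := Real.sq_sqrt (by positivity)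
  have hw : 3 * 10 ^ 8 ≤ w := Real.le_sqrt_of_sq_le (by linarith)
  have hX0 : X ≠ 0 := by
    rintro rfl
    omega
  have key : ∃ n : ℕ, 0 < (-1 : ℝ) ^ n * (X : ℝ) ∧ 12 * (3825 : ℝ) ^ n < w ^ 3 ∧
      w * (4 / 239) ^ n < 21 := by
    obtain hneg | hpos := lt_or_gt_of_ne hX0
    · obtain ⟨k, hk⟩ := exists_index hw 1 (by norm_num)
      refine ⟨2 * k + 1, ?_, hk⟩
      rw [pow_succ, pow_mul]
      norm_num
      exact hneg
    · obtain ⟨k, hk⟩ := exists_index hw 0 (by norm_num)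
      refine ⟨2 * k + 0, ?_, hk⟩
      rw [add_zero, pow_mul]
      norm_num
      exact hpos
  obtain ⟨n, hXn, hlow, hupp⟩ := key
  obtain ⟨h1, h2, h3, h4, h5, h6⟩ := hUV n
  exact not_of_pade_bounds hsc hs hc hS hS' hre him h1 h2 h3 h4 h5 h6 hz hX
    (by linarith) hwy hXn hlow hupp

/-- The solutions of `x ^ 2 + 1 = 2 * v ^ 2` in positive integers, in increasing order. -/
def negPell : ℕ → ℕ × ℕ
  | 0 => (1, 1)
  | k + 1 => (3 * (negPell k).1 + 4 * (negPell k).2, 2 * (negPell k).1 + 3 * (negPell k).2)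

theorem exists_negPell_eq {x v : ℕ} (h : x ^ 2 + 1 = 2 * v ^ 2) (hx : 0 < x) :
    ∃ k, negPell k = (x, v) := by
  induction v using Nat.strong_induction_on generalizing x with
  | _ v ih =>
    obtain hv | hv := le_or_gt v 1
    · have hx1 : x = 1 := by
        interval_cases v
        · omega
        · nlinarith
      have hv1 : v = 1 := by
        subst hx1
        nlinarith
      exact ⟨0, by rw [hx1, hv1]; rfl⟩
    · have h1 : v ≤ x := by nlinarith
      have h2 : 2 * x < 3 * v := by nlinarith
      have h3 : 4 * v < 3 * x := by nlinarith
      obtain ⟨x', hx'⟩ := Nat.exists_eq_add_of_lt h3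
      obtain ⟨v', hv'⟩ := Nat.exists_eq_add_of_lt h2
      have h4 : (x' + 1) ^ 2 + 1 = 2 * (v' + 1) ^ 2 := by
        zify at *
        have e1 : (x' : ℤ) + 1 = 3 * x - 4 * v := by linarith
        have e2 : (v' : ℤ) + 1 = 3 * v - 2 * x := by linarith
        rw [e1, e2]
        linarith
      obtain ⟨k, hk⟩ := ih (v' + 1) (by omega) h4 (by omega)
      refine ⟨k + 1, ?_⟩
      simp only [negPell, hk, Prod.mk.injEq]
      omega

theorem five_pow_le_negPell (k : ℕ) : 5 ^ k ≤ (negPell k).2 ∧ (negPell k).2 ≤ (negPell k).1 := by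
  induction k with
  | zero => decide
  | succ k ih =>
    simp only [negPell, pow_succ]
    omega

theorem negPell_snd_isSquare {k : ℕ} (hk : k < 49)
    (h : (negPell k).2.sqrt ^ 2 = (negPell k).2) : k = 0 ∨ k = 3 := by
  revert k
  decide +kernel

theorem eq_of_sq_add_one_eq_of_lt {x y : ℕ} (h : x ^ 2 + 1 = 2 * y ^ 4) (hx : 0 < x)
    (hy : y < 10 ^ 17) : (x = 1 ∧ y = 1) ∨ (x = 239 ∧ y = 13) := by
  obtain ⟨k, hk⟩ := exists_negPell_eq (v := y ^ 2) (by rw [h]; ring) hx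
  have hk49 : k < 49 := by
    have h1 := (five_pow_le_negPell k).1
    rw [hk] at h1
    by_contra! hc
    have h2 : 5 ^ 49 ≤ 5 ^ k := Nat.pow_le_pow_right (by norm_num) hc
    have h3 : y ^ 2 ≤ (10 ^ 17) ^ 2 := Nat.pow_le_pow_left hy.le 2
    norm_num at h2 h3
    linarith
  have hsq : (negPell k).2.sqrt ^ 2 = (negPell k).2 := by
    rw [hk, Nat.sqrt_eq']
  obtain rfl | rfl := negPell_snd_isSquare hk49 hsq
  · left
    simp only [negPell, Prod.mk.injEq] at hk
    exact ⟨hk.1.symm, by nlinarith⟩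
  · right
    simp only [negPell, Prod.mk.injEq] at hk
    exact ⟨hk.1.symm, by nlinarith⟩

theorem exists_one_add_I_mul_pow_four {x y : ℤ} (hy : 0 ≤ y) (h : x ^ 2 + 1 = 2 * y ^ 4) :
    ∃ a b X : ℤ, (⟨1, 1⟩ : GaussianInt) * ⟨a, b⟩ ^ 4 = ⟨1, X⟩ ∧
      X ^ 2 + 1 = 2 * (a ^ 2 + b ^ 2) ^ 4 ∧ y = a ^ 2 + b ^ 2 := by
  obtain ⟨c, d, hcd, hcd', hnorm, hodd, hcop⟩ := exists_isCoprime_conj h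
  obtain ⟨⟨a, b⟩, u, hu⟩ := GaussianInt.exists_associated_pow hcop hnorm
  have hNN : (a ^ 2 + b ^ 2) ^ 4 = y ^ 4 := by
    have h1 := congrArg Zsqrtd.norm hu
    have h2 : (u : GaussianInt).norm = 1 :=
      (Zsqrtd.norm_eq_one_iff' (by norm_num) (u : GaussianInt)).2 u.isUnit
    rw [Zsqrtd.norm_mul, h2, GaussianInt.norm_pow] at h1
    simp only [Zsqrtd.norm_def] at h1
    rw [← hnorm]
    linear_combination h1
  have hN : a ^ 2 + b ^ 2 = y := (pow_left_inj₀ (by positivity) hy (by norm_num)).1 hNN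
  have hyodd : Odd y := (Int.odd_pow' (by norm_num)).1 hodd
  have hz4 : (⟨a, b⟩ : GaussianInt) ^ 4 =
      ⟨(a ^ 2 + b ^ 2) ^ 2 - 8 * (a * b) ^ 2, 4 * (a * b * (a ^ 2 - b ^ 2))⟩ := by
    ext <;> simp [pow_succ] <;> ring
  have hz4' : (⟨a, -b⟩ : GaussianInt) ^ 4 =
      ⟨(a ^ 2 + b ^ 2) ^ 2 - 8 * (a * b) ^ 2, -(4 * (a * b * (a ^ 2 - b ^ 2)))⟩ := by
    ext <;> simp [pow_succ] <;> ring
  have hsq : ∃ m, (a ^ 2 + b ^ 2) ^ 2 = 4 * m + 1 := by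
    obtain ⟨k, hk⟩ := hyodd
    exact ⟨k ^ 2 + k, by rw [hN, hk]; ring⟩
  rw [hz4] at hu
  have hre := congrArg Zsqrtd.re hu
  have him := congrArg Zsqrtd.im hu
  obtain ⟨m, hm⟩ := hsq
  rw [hm] at hre him hz4 hz4'
  generalize (a * b) ^ 2 = s at *
  generalize a * b * (a ^ 2 - b ^ 2) = t at *
  rcases GaussianInt.isUnit_cases u.isUnit with h' | h' | h' | h' <;> rw [h'] at hre him <;>
    simp at hre him
  · refine ⟨a, -b, x, ?_, ?_, ?_⟩
    · rw [hz4']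
      ext <;> simp <;> omega
    · rw [neg_sq, hN, h]
    · rw [neg_sq, hN]
  · omega
  · refine ⟨a, b, -x, ?_, ?_, hN.symm⟩
    · rw [hz4]
      ext <;> simp <;> omega
    · rw [hN, neg_sq, h]
  · omega

/-- Ljunggren's theorem. -/
theorem eq_of_sq_add_one_eq_two_mul_pow_four {x y : ℕ} (hx : 0 < x)
    (h : x ^ 2 + 1 = 2 * y ^ 4) : (x = 1 ∧ y = 1) ∨ (x = 239 ∧ y = 13) := by
  obtain ⟨a, b, X, hz, hX, hy⟩ := exists_one_add_I_mul_pow_four (x := x) (y := y)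
    (by positivity) (by exact_mod_cast h)
  have hlt := norm_lt_of_one_add_I_mul_pow_four hz hX
  rw [← hy] at hlt
  exact eq_of_sq_add_one_eq_of_lt h hx (by exact_mod_cast hlt)

theorem even_sq_add_one_ne {x y r : ℕ} (hx : 0 < x) (hr : Even r) : x ^ 2 + 1 ≠ y ^ r := by
  obtain ⟨k, rfl⟩ := hr
  intro h
  rw [← two_mul, mul_comm, pow_mul] at h
  have h1 : x < y ^ k := lt_of_pow_lt_pow_left₀ 2 (Nat.zero_le _) (by omega)
  nlinarith

/-- (i) There are no positive integers `x, y, r` with `r > 1` and `x² + 1 = y^r`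
(Lebesgue); (ii) if `x, y, r` are positive integers with `r > 2` and `x² + 1 = 2y^r`, then
`x = y = 1` or `(x,y,r) = (239,13,4)` (Størmer). -/
theorem lebesgue_and_stormer :
    (∀ x y r : ℕ, 0 < x → 0 < y → 1 < r → x ^ 2 + 1 ≠ y ^ r) ∧
    (∀ x y r : ℕ, 0 < x → 0 < y → 2 < r → x ^ 2 + 1 = 2 * y ^ r →
      (x = 1 ∧ y = 1) ∨ (x = 239 ∧ y = 13 ∧ r = 4)) := by
  refine ⟨fun x y r hx _ hr h => ?_, fun x y r hx hy hr h => ?_⟩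
  · obtain he | ho := Nat.even_or_odd r
    · exact even_sq_add_one_ne hx he h
    · have := lebesgue_odd (x := x) (y := y) hr ho (by exact_mod_cast h)
      omega
  obtain ⟨k, m, hm, rfl⟩ := Nat.exists_eq_two_pow_mul_odd (show r ≠ 0 by omega)
  obtain hm1 | hm1 : m = 1 ∨ 2 ≤ m := by
    have := hm.pos
    omega
  · subst hm1
    obtain ⟨j, rfl⟩ : ∃ j, k = j + 2 := by
      refine ⟨k - 2, ?_⟩
      by_contra hk
      have : k < 2 := by omega
      interval_cases k <;> omega
    rw [mul_one, pow_add, pow_mul] at h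
    obtain ⟨h1, h2⟩ | ⟨h1, h2⟩ := eq_of_sq_add_one_eq_two_mul_pow_four hx h
    · exact Or.inl ⟨h1, (Nat.pow_eq_one.1 h2).resolve_right (by positivity)⟩
    · have hp : (y ^ 2 ^ j).Prime := by
        rw [h2]
        norm_num
      have hj : 2 ^ j = 1 := by
        by_contra hj
        exact Nat.Prime.not_prime_pow' hj hp
      rw [hj, pow_one] at h2
      exact Or.inr ⟨h1, h2, by rw [pow_add, hj]; rfl⟩
  · rw [pow_mul] at h
    have h1 := stormer_odd (x := x) (y := (y ^ 2 ^ k : ℕ)) hm1 hm (by exact_mod_cast h)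
    have hx1 : x = 1 := by
      have : x ^ 2 = 1 := by exact_mod_cast h1
      simpa using this
    subst hx1
    have h2 : (y ^ 2 ^ k) ^ m = 1 := by omega
    rw [← pow_mul] at h2
    exact Or.inl ⟨rfl, (Nat.pow_eq_one.1 h2).resolve_right (by omega)⟩
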